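/- arXiv:2504.18672 — 4 statements merged into one kernel-verified Lean document; each statement's English description precedes it below -/
import Mathlib

section
/- Let X : Ω → ℝ be an integrable random variable and Y : Ω → ℝ^d (d ≥ 1) a random vector on a probability space (Ω, F, P). Then the following are equivalent: (i) the law of X is the standard Gaussian measure γ = N(0,1) and X is independent of Y; (ii) for every measurable function f : ℝ × ℝ^d → ℝ such that for each y ∈ ℝ^d the map x ↦ f(x,y) is differentiable, and such that both ω ↦ ∂_x f(X(ω),Y(ω)) and ω ↦ X(ω)·f(X(ω),Y(ω)) are integrable, one has E[∂_x f(X,Y)] = E[X·f(X,Y)]. -/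
open MeasureTheory ProbabilityTheory

lemma stein_one_dim (g : ℝ → ℝ) (hg : Differentiable ℝ g)
    (h1 : Integrable (deriv g) (gaussianReal 0 1))
    (h2 : Integrable (fun x => x * g x) (gaussianReal 0 1)) :
    ∫ x, deriv g x ∂(gaussianReal 0 1) = ∫ x, x * g x ∂(gaussianReal 0 1) := by
  have key : ∀ h : ℝ → ℝ, Integrable h (gaussianReal 0 1) →
      Integrable (fun x => gaussianPDFReal 0 1 x * h x) := by
    intro h hh
    rw [gaussianReal_of_var_ne_zero _ one_ne_zero,
      integrable_withDensity_iff_integrable_smul' (measurable_gaussianPDF _ _)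
        (ae_of_all _ fun _ => gaussianPDF_lt_top)] at hh
    simpa using hh
  have hgi : Integrable g (gaussianReal 0 1) := by
    obtain ⟨C, hC⟩ := (isCompact_Icc (a := (-1:ℝ)) (b := 1)).exists_bound_of_continuousOn
      hg.continuous.continuousOn
    refine ((integrable_const C).add h2.norm).mono' hg.continuous.aestronglyMeasurable
      (ae_of_all _ fun x => ?_)
    simp only [Pi.add_apply, norm_mul]
    have hC0 : 0 ≤ C := (norm_nonneg _).trans (hC 0 (by simp))
    by_cases hx : x ∈ Set.Icc (-1:ℝ) 1
    · have := hC x hx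
      have : 0 ≤ ‖x‖ * ‖g x‖ := by positivity
      linarith
    · have : 1 ≤ ‖x‖ := by
        rw [Real.norm_eq_abs]
        by_contra hlt
        exact hx (abs_le.mp (not_le.mp hlt).le)
      nlinarith [norm_nonneg (g x)]
  have hd : ∀ x, HasDerivAt (gaussianPDFReal 0 1) (-x * gaussianPDFReal 0 1 x) x := by
    intro x
    rw [gaussianPDFReal_def]
    have h := ((((hasDerivAt_id x).sub_const 0).pow 2).neg.div_const (2 * ((1 : NNReal) : ℝ))).exp.const_mul
      ((√(2 * Real.pi * ((1 : NNReal) : ℝ)))⁻¹)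
    refine HasDerivAt.congr_deriv (f := fun x => (√(2 * Real.pi * ((1 : NNReal) : ℝ)))⁻¹ *
      Real.exp (-(x - 0) ^ 2 / (2 * ((1 : NNReal) : ℝ)))) h ?_
    simp
    ring
  have h0 := integral_eq_zero_of_hasDerivAt_of_integrable
    (f := fun x => gaussianPDFReal 0 1 x * g x)
    (f' := fun x => gaussianPDFReal 0 1 x * deriv g x - gaussianPDFReal 0 1 x * (x * g x))
    (fun x => by
      refine HasDerivAt.congr_deriv (f := fun x => gaussianPDFReal 0 1 x * g x)
        ((hd x).mul (hg x).hasDerivAt) ?_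
      ring) ((key _ h1).sub (key _ h2)) (key _ hgi)
  rw [integral_sub (key _ h1) (key _ h2)] at h0
  rw [integral_gaussianReal_eq_integral_smul one_ne_zero,
    integral_gaussianReal_eq_integral_smul one_ne_zero]
  simp only [smul_eq_mul]
  linarith

lemma measurable_partial {d : ℕ} (f : ℝ → (Fin d → ℝ) → ℝ) (hf : Measurable (Function.uncurry f))
    (hd : ∀ y, Differentiable ℝ fun x => f x y) :
    Measurable (fun p : ℝ × (Fin d → ℝ) => deriv (fun x => f x p.2) p.1) := by
  refine measurable_of_tendsto_metrizable
    (f := fun (n : ℕ) (p : ℝ × (Fin d → ℝ)) => ((1 / ((n : ℝ) + 1))⁻¹) * (f (p.1 + 1 / ((n : ℝ) + 1)) p.2 - f p.1 p.2)) ?_ ?_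
  · intro n
    have h1 : Measurable (fun p : ℝ × (Fin d → ℝ) => f (p.1 + 1 / ((n : ℝ) + 1)) p.2) :=
      hf.comp (f := fun p : ℝ × (Fin d → ℝ) => (p.1 + 1 / ((n : ℝ) + 1), p.2)) (by fun_prop)
    have h2 : Measurable (fun p : ℝ × (Fin d → ℝ) => f p.1 p.2) := hf
    exact (h1.sub h2).const_mul _
  · rw [tendsto_pi_nhds]
    intro p
    have h := (hd p.2 p.1).hasDerivAt.tendsto_slope_zero
    refine h.comp (tendsto_nhdsWithin_iff.mpr ⟨tendsto_one_div_add_atTop_nhds_zero_nat, ?_⟩)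
    refine Filter.Eventually.of_forall fun n => ?_
    have : (1 / ((n : ℝ) + 1)) ≠ 0 := by positivity
    exact this

lemma charFun_stein (μ : Measure ℝ) [IsFiniteMeasure μ] (hi : Integrable id μ)
    (hc : ∀ t : ℝ, ∫ x, t * Real.cos (t * x) ∂μ = ∫ x, x * Real.sin (t * x) ∂μ)
    (hs : ∀ t : ℝ, ∫ x, -(t * Real.sin (t * x)) ∂μ = ∫ x, x * Real.cos (t * x) ∂μ) :
    μ = μ Set.univ • gaussianReal 0 1 := by
  have hbc : ∀ t : ℝ, Integrable (fun x : ℝ => Real.cos (t * x)) μ := fun t =>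
    (integrable_const (1:ℝ)).mono' (by fun_prop) (ae_of_all _ fun x => by
      simpa using Real.abs_cos_le_one _)
  have hbs : ∀ t : ℝ, Integrable (fun x : ℝ => Real.sin (t * x)) μ := fun t =>
    (integrable_const (1:ℝ)).mono' (by fun_prop) (ae_of_all _ fun x => by
      simpa using Real.abs_sin_le_one _)
  have hxc : ∀ t : ℝ, Integrable (fun x : ℝ => x * Real.cos (t * x)) μ := fun t =>
    hi.norm.mono' (by fun_prop) (ae_of_all _ fun x => by
      simpa using mul_le_of_le_one_right (abs_nonneg x) (Real.abs_cos_le_one (t * x)))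
  have hxs : ∀ t : ℝ, Integrable (fun x : ℝ => x * Real.sin (t * x)) μ := fun t =>
    hi.norm.mono' (by fun_prop) (ae_of_all _ fun x => by
      simpa using mul_le_of_le_one_right (abs_nonneg x) (Real.abs_sin_le_one (t * x)))
  have hm : MemLp id ((1 : ℕ) : ENNReal) μ := by
    simpa [memLp_one_iff_integrable] using hi
  have hcd : Differentiable ℝ (charFun μ) := by
    have : ContDiff ℝ (1 : ℕ) (charFun μ) := contDiff_charFun hm
    exact this.differentiable (by norm_num)
  have hderiv : ∀ t : ℝ, deriv (charFun μ) t = -t * charFun μ t := by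
    intro t
    have h := iteratedDeriv_charFun (t := t) hm
    rw [iteratedDeriv_one] at h
    rw [h, charFun_apply_real]
    have e1 : ∀ x : ℝ, Complex.exp (t * x * Complex.I) =
        (Real.cos (t * x) : ℂ) + (Real.sin (t * x) : ℂ) * Complex.I := by
      intro x
      rw [Complex.exp_mul_I]; push_cast; rfl
    have e2 : ∀ x : ℝ, (x : ℂ) ^ 1 * Complex.exp (t * x * Complex.I) =
        ((x * Real.cos (t * x) : ℝ) : ℂ) + ((x * Real.sin (t * x) : ℝ) : ℂ) * Complex.I := by
      intro x
      rw [e1]; push_cast; ring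
    simp_rw [e2, e1]
    rw [integral_add (hxc t).ofReal ((hxs t).ofReal.mul_const _),
      integral_add (hbc t).ofReal ((hbs t).ofReal.mul_const _),
      integral_mul_const, integral_mul_const, integral_complex_ofReal, integral_complex_ofReal,
      integral_complex_ofReal, integral_complex_ofReal, ← hc, ← hs, integral_neg,
      integral_const_mul, integral_const_mul]
    push_cast
    ring_nf
    simp only [Complex.I_sq]
    ring
  have hconst : ∀ t : ℝ, charFun μ t * Complex.exp ((t:ℂ) ^ 2 / 2) = charFun μ 0 := by
    intro t
    have hE : ∀ t : ℝ, HasDerivAt (fun t : ℝ => charFun μ t * Complex.exp ((t:ℂ) ^ 2 / 2)) 0 t := by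
      intro t
      have h1 : HasDerivAt (fun t : ℝ => (t:ℂ) ^ 2 / 2) (t : ℂ) t := by
        have := (((hasDerivAt_id (t:ℂ)).pow 2).div_const 2).comp_ofReal
        refine HasDerivAt.congr_deriv (f := fun t : ℝ => (t:ℂ) ^ 2 / 2) this ?_
        simp
      have h2 := (hcd t).hasDerivAt.mul h1.cexp
      rw [hderiv] at h2
      refine HasDerivAt.congr_deriv
        (f := fun t : ℝ => charFun μ t * Complex.exp ((t:ℂ) ^ 2 / 2)) h2 ?_
      ring
    have := is_const_of_deriv_eq_zero (fun t => (hE t).differentiableAt) (fun t => (hE t).deriv) t 0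
    simpa using this
  have : IsFiniteMeasure (μ Set.univ • gaussianReal 0 1) :=
    Measure.smul_finite _ (measure_ne_top _ _)
  refine Measure.ext_of_charFun (funext fun t => ?_)
  have hR : charFun (μ Set.univ • gaussianReal 0 1) t = charFun μ 0 * charFun (gaussianReal 0 1) t := by
    rw [charFun_zero, charFun_apply_real, charFun_apply_real, integral_smul_measure]
    simp [Measure.real]
  rw [hR, charFun_gaussianReal, ← hconst t, mul_assoc, ← Complex.exp_add]
  simp

theorem stmt1 {Ω : Type*} [MeasurableSpace Ω] (P : Measure Ω) [IsProbabilityMeasure P]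
    (d : ℕ) (hd : 1 ≤ d) (X : Ω → ℝ) (Y : Ω → (Fin d → ℝ))
    (hX : Measurable X) (hY : Measurable Y) (hXint : Integrable X P) :
    (Measure.map X P = gaussianReal 0 1 ∧ IndepFun X Y P) ↔
    (∀ f : ℝ → (Fin d → ℝ) → ℝ,
      Measurable (Function.uncurry f) →
      (∀ y, Differentiable ℝ fun x => f x y) →
      Integrable (fun ω => deriv (fun x => f x (Y ω)) (X ω)) P →
      Integrable (fun ω => X ω * f (X ω) (Y ω)) P →
      ∫ ω, deriv (fun x => f x (Y ω)) (X ω) ∂P = ∫ ω, X ω * f (X ω) (Y ω) ∂P) := by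
  constructor
  · rintro ⟨hlaw, hind⟩ f hf hfd h1 h2
    have hXY : Measurable (fun ω => (X ω, Y ω)) := hX.prodMk hY
    have hjoint : P.map (fun ω => (X ω, Y ω)) = (gaussianReal 0 1).prod (P.map Y) := by
      rw [(indepFun_iff_map_prod_eq_prod_map_map hX.aemeasurable hY.aemeasurable).mp hind, hlaw]
    have : IsProbabilityMeasure (P.map Y) := Measure.isProbabilityMeasure_map hY.aemeasurable
    have hD := measurable_partial f hf hfd
    have hM : Measurable (fun p : ℝ × (Fin d → ℝ) => p.1 * f p.1 p.2) := measurable_fst.mul hf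
    have i1 := (integrable_map_measure hD.aestronglyMeasurable hXY.aemeasurable).mpr h1
    have i2 := (integrable_map_measure hM.aestronglyMeasurable hXY.aemeasurable).mpr h2
    have j1 := integral_map (μ := P) hXY.aemeasurable hD.aestronglyMeasurable
    have j2 := integral_map (μ := P) hXY.aemeasurable hM.aestronglyMeasurable
    rw [hjoint] at i1 i2 j1 j2
    rw [← j1, ← j2, integral_prod_symm _ i1, integral_prod_symm _ i2]
    refine integral_congr_ae ?_
    filter_upwards [i1.prod_left_ae, i2.prod_left_ae] with y k1 k2
    exact stein_one_dim _ (hfd y) k1 k2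
  · intro H
    have main : ∀ B : Set (Fin d → ℝ), MeasurableSet B →
        (P.restrict (Y ⁻¹' B)).map X = P (Y ⁻¹' B) • gaussianReal 0 1 := by
      intro B hB
      have hYB : MeasurableSet (Y ⁻¹' B) := hY hB
      have gen : ∀ g g' : ℝ → ℝ, (∀ x, HasDerivAt g (g' x) x) → Measurable g' →
          (∃ C, ∀ x, ‖g x‖ ≤ C) → (∃ C, ∀ x, ‖g' x‖ ≤ C) →
          ∫ x, g' x ∂((P.restrict (Y ⁻¹' B)).map X) =
            ∫ x, x * g x ∂((P.restrict (Y ⁻¹' B)).map X) := by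
        rintro g g' hg hg'm ⟨C, hC⟩ ⟨C', hC'⟩
        have hgm : Measurable g :=
          (continuous_iff_continuousAt.mpr fun x => (hg x).continuousAt).measurable
        have hder : ∀ ω, deriv (fun x => B.indicator (fun _ => g x) (Y ω)) (X ω) =
            (Y ⁻¹' B).indicator (fun ω => g' (X ω)) ω := by
          intro ω
          by_cases hω : Y ω ∈ B
          · simp [hω, (hg (X ω)).deriv]
          · simp [hω]
        have hmul : ∀ ω, X ω * B.indicator (fun _ => g (X ω)) (Y ω) =
            (Y ⁻¹' B).indicator (fun ω => X ω * g (X ω)) ω := by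
          intro ω
          by_cases hω : Y ω ∈ B <;> simp [hω]
        have h := H (fun x y => B.indicator (fun _ => g x) y) ?_ ?_ ?_ ?_
        · simp_rw [hder, hmul] at h
          rw [integral_indicator hYB, integral_indicator hYB] at h
          rw [integral_map hX.aemeasurable hg'm.aestronglyMeasurable,
            integral_map hX.aemeasurable (f := fun x => x * g x)
              (measurable_id.mul hgm).aestronglyMeasurable]
          exact h
        · have : (Function.uncurry fun x y => B.indicator (fun _ => g x) y) =
              (Prod.snd ⁻¹' B).indicator (fun p : ℝ × (Fin d → ℝ) => g p.1) := by
            ext p; rfl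
          rw [this]
          exact (hgm.comp measurable_fst).indicator (measurable_snd hB)
        · intro y
          by_cases hy : y ∈ B
          · simp only [hy, Set.indicator_of_mem]
            exact fun x => (hg x).differentiableAt
          · simp [hy]
        · simp_rw [hder]
          refine Integrable.indicator ?_ hYB
          exact (integrable_const C').mono' (hg'm.comp hX).aestronglyMeasurable
            (ae_of_all _ fun ω => hC' _)
        · simp_rw [hmul]
          refine Integrable.indicator ?_ hYB
          exact hXint.mul_bdd (c := C) (hgm.comp hX).aestronglyMeasurable (ae_of_all _ fun ω => hC _)
      have := charFun_stein ((P.restrict (Y ⁻¹' B)).map X) ?_ ?_ ?_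
      · rwa [Measure.map_apply hX MeasurableSet.univ, Set.preimage_univ,
          Measure.restrict_apply_univ] at this
      · exact (integrable_map_measure measurable_id.aestronglyMeasurable hX.aemeasurable).mpr
          hXint.restrict
      · intro t
        refine gen (fun x => Real.sin (t * x)) (fun x => t * Real.cos (t * x)) ?_ (by fun_prop)
          ⟨1, fun x => Real.abs_sin_le_one _⟩ ⟨|t|, fun x => ?_⟩
        · intro x
          refine HasDerivAt.congr_deriv (f := fun x => Real.sin (t * x))
            ((hasDerivAt_id x).const_mul t).sin ?_
          simp only [id]; ring
        · simpa using mul_le_of_le_one_right (abs_nonneg t) (Real.abs_cos_le_one (t * x))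
      · intro t
        refine gen (fun x => Real.cos (t * x)) (fun x => -(t * Real.sin (t * x))) ?_ (by fun_prop)
          ⟨1, fun x => Real.abs_cos_le_one _⟩ ⟨|t|, fun x => ?_⟩
        · intro x
          refine HasDerivAt.congr_deriv (f := fun x => Real.cos (t * x))
            ((hasDerivAt_id x).const_mul t).cos ?_
          simp only [id]; ring
        · simpa using mul_le_of_le_one_right (abs_nonneg t) (Real.abs_sin_le_one (t * x))
    have hlaw : Measure.map X P = gaussianReal 0 1 := by
      simpa using main Set.univ MeasurableSet.univ
    refine ⟨hlaw, indepFun_iff_measure_inter_preimage_eq_mul.mpr fun s t hs ht => ?_⟩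
    have h := congrArg (fun m => m s) (main t ht)
    simp only [Measure.map_apply hX hs, Measure.restrict_apply (hX hs), Measure.smul_apply,
      smul_eq_mul] at h
    rw [h, ← hlaw, Measure.map_apply hX hs, mul_comm]
end

section
/- Let d ≥ 1 and let h : ℝ × ℝ^d → ℝ be continuously differentiable and Lipschitz with Lipschitz constant Lip(h) ≤ 1. Define f_h(x,y) = e^{x²/2} ∫_{−∞}^{x} (h(t,y) − ∫_ℝ h(z,y) γ(dz)) e^{−t²/2} dt. Then for every y ∈ ℝ^d the map x ↦ f_h(x,y) is twice differentiable and satisfies the Stein equation ∂_x f_h(x,y) − x·f_h(x,y) = h(x,y) − ∫_ℝ h(z,y) γ(dz) for all x ∈ ℝ; moreover |f_h(x,y)| ≤ 2, |∂_x f_h(x,y)| ≤ √(2/π), and |∂²_{xx} f_h(x,y)| ≤ 2 for all (x,y) ∈ ℝ × ℝ^d. -/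
open MeasureTheory ProbabilityTheory

namespace SteinAux

noncomputable def E (t : ℝ) : ℝ := Real.exp (-t ^ 2 / 2)
noncomputable def I (x : ℝ) : ℝ := ∫ t in Set.Iic x, E t
noncomputable def J (x : ℝ) : ℝ := ∫ t in Set.Ioi x, E t
noncomputable def S : ℝ := √(2 * Real.pi)

lemma E_eq (t : ℝ) : E t = Real.exp (-(1/2) * t ^ 2) := by
  unfold E; congr 1; ring

lemma E_pos (t : ℝ) : 0 < E t := Real.exp_pos _

lemma E_neg (t : ℝ) : E (-t) = E t := by simp [E]

lemma E_hasDeriv (x : ℝ) : HasDerivAt E (-x * E x) x := by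
  have : HasDerivAt (fun t : ℝ => -t ^ 2 / 2) (-x) x := by
    have := ((hasDerivAt_id x).pow 2).neg.div_const 2
    refine HasDerivAt.congr_deriv this ?_
    simp
    ring
  have h2 := this.exp
  refine HasDerivAt.congr_deriv h2 ?_
  simp only [E]; ring

lemma E_cont : Continuous E := by unfold E; fun_prop

lemma E_int : Integrable E := by
  have := integrable_exp_neg_mul_sq (b := 1/2) (by norm_num)
  exact this.congr (Filter.Eventually.of_forall fun t => (E_eq t).symm)

lemma tE_int : Integrable (fun t => t * E t) := by
  have := integrable_mul_exp_neg_mul_sq (b := 1/2) (by norm_num)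
  exact this.congr (Filter.Eventually.of_forall fun t => by simp only [E_eq])

lemma ttE_int : Integrable (fun t => t ^ 2 * E t) := by
  have := integrable_rpow_mul_exp_neg_mul_sq (b := 1/2) (by norm_num) (s := 2) (by norm_num)
  exact this.congr (Filter.Eventually.of_forall fun t => by simp [E_eq])

lemma E_total : ∫ t, E t = S := by
  have := integral_gaussian (1/2)
  simp only [E_eq, S]
  rw [this]; congr 1; ring

lemma S_pos : 0 < S := Real.sqrt_pos.2 (by positivity)

lemma IJ (x : ℝ) : I x + J x = S := by
  rw [← E_total]
  exact intervalIntegral.integral_Iic_add_Ioi E_int.integrableOn E_int.integrableOn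

lemma I_eq (x : ℝ) : I x = J (-x) := by
  unfold I J
  rw [← integral_comp_neg_Iic]
  simp only [E_neg]

lemma J_nonneg (x : ℝ) : 0 ≤ J x := integral_nonneg fun t => (E_pos t).le

lemma I_nonneg (x : ℝ) : 0 ≤ I x := integral_nonneg fun t => (E_pos t).le

lemma I0 : I 0 = S / 2 := by
  have h1 := IJ 0
  have h2 := I_eq 0
  simp at h2
  linarith

lemma prim_hasDeriv {g : ℝ → ℝ} (hg : Continuous g) (hi : Integrable g) (x : ℝ) :
    HasDerivAt (fun x => ∫ t in Set.Iic x, g t) (g x) x := by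
  have h1 : (fun x => ∫ t in Set.Iic x, g t)
      = fun x => (∫ t in (0:ℝ)..x, g t) + ∫ t in Set.Iic 0, g t := by
    funext u
    rw [← intervalIntegral.integral_Iic_sub_Iic hi.integrableOn hi.integrableOn]
    ring
  rw [h1]
  exact (intervalIntegral.integral_hasDerivAt_right (hg.intervalIntegrable _ _)
    (hg.stronglyMeasurableAtFilter _ _) hg.continuousAt).add_const _

lemma I_hasDeriv (x : ℝ) : HasDerivAt I (E x) x := prim_hasDeriv E_cont E_int x

lemma tendsto_aux (n : ℕ) : Filter.Tendsto (fun x => x ^ n * E x) Filter.atTop (nhds 0) := by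
  have h := (tendsto_rpow_abs_mul_exp_neg_mul_sq_cocompact (a := 1/2) (by norm_num) n).mono_left
    atTop_le_cocompact
  refine h.congr' ?_
  filter_upwards [Filter.eventually_ge_atTop 0] with x hx
  rw [E_eq, abs_of_nonneg hx, Real.rpow_natCast]

lemma int_tE (x : ℝ) : ∫ t in Set.Ioi x, t * E t = E x := by
  have h := integral_Ioi_of_hasDerivAt_of_tendsto (f := fun t => - E t) (f' := fun t => t * E t)
    (a := x) (m := 0) E_cont.neg.continuousWithinAt
    (fun t _ => by
      have := (E_hasDeriv t).neg
      refine HasDerivAt.congr_deriv this ?_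
      ring) tE_int.integrableOn
    (by simpa using (tendsto_aux 0).neg)
  rw [h]; ring

lemma int_ttE (x : ℝ) : ∫ t in Set.Ioi x, (t ^ 2 * E t - E t) = x * E x := by
  have h := integral_Ioi_of_hasDerivAt_of_tendsto (f := fun t => - (t * E t))
    (f' := fun t => t ^ 2 * E t - E t)
    (a := x) (m := 0) (continuous_id.mul E_cont).neg.continuousWithinAt
    (fun t _ => by
      have := ((hasDerivAt_id t).mul (E_hasDeriv t)).neg
      refine HasDerivAt.congr_deriv this ?_
      (try simp only [id]); ring) (ttE_int.sub E_int).integrableOn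
    (by simpa using (tendsto_aux 1).neg)
  rw [h]; ring

lemma int_b (x : ℝ) : ∫ t in Set.Ioi x, (t - x) * E t = E x - x * J x := by
  have : ∀ t, (t - x) * E t = t * E t - x * E t := fun t => by ring
  simp only [this]
  rw [integral_sub tE_int.integrableOn (E_int.const_mul x).integrableOn, int_tE,
    integral_const_mul]
  rfl

lemma b_nonneg (x : ℝ) : 0 ≤ E x - x * J x := by
  rw [← int_b]
  exact setIntegral_nonneg measurableSet_Ioi fun t ht =>
    mul_nonneg (sub_nonneg.2 (le_of_lt ht)) (E_pos t).le

lemma a_nonneg (x : ℝ) : 0 ≤ E x + x * I x := by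
  have := b_nonneg (-x)
  rw [E_neg, ← I_eq] at this
  linarith

lemma mills_J (x : ℝ) : 0 ≤ (1 + x ^ 2) * J x - x * E x := by
  have h : ∫ t in Set.Ioi x, (t - x) ^ 2 * E t = (1 + x ^ 2) * J x - x * E x := by
    have : ∀ t, (t - x) ^ 2 * E t
        = (t ^ 2 * E t - E t) + ((1 + x ^ 2) * E t - (2 * x) * (t * E t)) := fun t => by ring
    simp only [this]
    have i1 : Integrable (fun t => t ^ 2 * E t - E t) := ttE_int.sub E_int
    have i2 : Integrable (fun t => (1 + x ^ 2) * E t - (2 * x) * (t * E t)) :=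
      (E_int.const_mul _).sub (tE_int.const_mul _)
    rw [integral_add i1.integrableOn i2.integrableOn,
      integral_sub (E_int.const_mul _).integrableOn (tE_int.const_mul _).integrableOn, int_ttE,
      integral_const_mul, integral_const_mul, int_tE]
    change x * E x + ((1 + x ^ 2) * J x - _) = _
    ring
  rw [← h]
  exact integral_nonneg fun t => mul_nonneg (sq_nonneg _) (E_pos t).le

lemma mills_I (x : ℝ) : 0 ≤ (1 + x ^ 2) * I x + x * E x := by
  have := mills_J (-x)
  rw [E_neg, ← I_eq] at this
  have h2 : (-x) ^ 2 = x ^ 2 := by ring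
  rw [h2] at this
  linarith

/-- third auxiliary function, the second derivative of `N` -/
lemma N2_nonpos {x : ℝ} (hx : 0 ≤ x) : -2 * I x + (S + x) * E x ≤ 0 := by
  have hd : ∀ x, HasDerivAt (fun x => -2 * I x + (S + x) * E x)
      (-E x * (1 + x * S + x ^ 2)) x := fun x => by
    have := ((I_hasDeriv x).const_mul (-2)).add
      (((hasDerivAt_id x).const_add S).mul (E_hasDeriv x))
    refine HasDerivAt.congr_deriv this ?_
    (try simp only [id]); ring
  have hanti : AntitoneOn (fun x => -2 * I x + (S + x) * E x) (Set.Ici 0) := by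
    apply antitoneOn_of_deriv_nonpos (convex_Ici 0)
      (fun x _ => (hd x).continuousAt.continuousWithinAt)
      (fun x _ => (hd x).differentiableAt.differentiableWithinAt)
    intro x hx
    rw [interior_Ici] at hx
    have hx' : (0:ℝ) < x := hx
    rw [(hd x).deriv]
    have := E_pos x
    have := S_pos
    have : 0 ≤ E x * (1 + x * S + x ^ 2) := by positivity
    linarith
  have h := hanti (Set.self_mem_Ici) (Set.mem_Ici.2 hx) hx
  simp only [I0] at h
  have : E 0 = 1 := by simp [E]
  rw [this] at h
  linarith

noncomputable def N (x : ℝ) : ℝ := (S - x) * (E x + x * I x) - 2 * I x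

lemma a_hasDeriv (x : ℝ) : HasDerivAt (fun x => E x + x * I x) (I x) x := by
  have := (E_hasDeriv x).add ((hasDerivAt_id x).mul (I_hasDeriv x))
  refine HasDerivAt.congr_deriv this ?_
  (try simp only [id]); ring

lemma N_hasDeriv (x : ℝ) : HasDerivAt N ((S - 2 * x) * I x - 3 * E x) x := by
  have := (((hasDerivAt_id x).const_sub S).mul (a_hasDeriv x)).sub ((I_hasDeriv x).const_mul 2)
  refine HasDerivAt.congr_deriv this ?_
  (try simp only [id]); ring

lemma N1_hasDeriv (x : ℝ) : HasDerivAt (fun x => (S - 2 * x) * I x - 3 * E x)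
    (-2 * I x + (S + x) * E x) x := by
  have := ((((hasDerivAt_id x).const_mul 2).const_sub S).mul (I_hasDeriv x)).sub
    ((E_hasDeriv x).const_mul 3)
  refine HasDerivAt.congr_deriv this ?_
  (try simp only [id]); ring

lemma N_concave : ConcaveOn ℝ (Set.Ici 0) N := by
  have hd : deriv N = fun x => (S - 2 * x) * I x - 3 * E x := funext fun x => (N_hasDeriv x).deriv
  apply concaveOn_of_deriv2_nonpos (convex_Ici 0)
    (fun x _ => (N_hasDeriv x).continuousAt.continuousWithinAt)
    (fun x _ => (N_hasDeriv x).differentiableAt.differentiableWithinAt)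
  · rw [hd]
    exact fun x _ => (N1_hasDeriv x).differentiableAt.differentiableWithinAt
  · intro x hx
    rw [interior_Ici] at hx
    simp only [Function.iterate_succ, Function.iterate_zero, Function.comp, id]
    rw [hd, (N1_hasDeriv x).deriv]
    exact N2_nonpos (le_of_lt hx)

lemma N_zero : N 0 = 0 := by
  simp [N, I0, E]; ring

noncomputable def Z (x : ℝ) : ℝ :=
  E x / (E x + x * I x) ^ 2 - (E x - x * J x) / (E x + x * I x)

lemma a_pos {x : ℝ} (hx : 0 ≤ x) : 0 < E x + x * I x :=
  add_pos_of_pos_of_nonneg (E_pos x) (mul_nonneg hx (I_nonneg x))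

lemma J_hasDeriv (x : ℝ) : HasDerivAt J (-E x) x := by
  have : J = fun x => S - I x := funext fun x => by have := IJ x; linarith
  rw [this]
  exact (I_hasDeriv x).const_sub S

lemma b_hasDeriv (x : ℝ) : HasDerivAt (fun x => E x - x * J x) (-J x) x := by
  have := (E_hasDeriv x).sub ((hasDerivAt_id x).mul (J_hasDeriv x))
  refine HasDerivAt.congr_deriv this ?_
  (try simp only [id]); ring

lemma Z_hasDeriv {x : ℝ} (hx : 0 ≤ x) :
    HasDerivAt Z (E x / (E x + x * I x) ^ 3 * N x) x := by
  have ha := a_pos hx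
  have := ((E_hasDeriv x).div ((a_hasDeriv x).pow 2) (pow_ne_zero 2 ha.ne')).sub
    ((b_hasDeriv x).div (a_hasDeriv x) ha.ne')
  refine HasDerivAt.congr_deriv this ?_
  have hJ : J x = S - I x := by have := IJ x; linarith
  rw [hJ]
  have ha' := ha.ne'
  simp only [N, Pi.pow_apply]
  field_simp
  ring

lemma Z_nonneg {x : ℝ} (hx : 0 ≤ x) : 0 ≤ Z x := by
  by_contra! hneg
  have hZ0 : Z 0 = 0 := by simp [Z, E]
  have hx0 : 0 < x := lt_of_le_of_ne hx (by rintro rfl; linarith)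
  obtain ⟨ξ, ⟨hξ0, hξx⟩, hξ⟩ := exists_hasDerivAt_eq_slope Z _ hx0
    (fun t ht => (Z_hasDeriv ht.1).continuousAt.continuousWithinAt)
    (fun t ht => Z_hasDeriv (le_of_lt ht.1))
  have hNξ : N ξ < 0 := by
    have h1 : (Z x - Z 0) / (x - 0) < 0 := by
      rw [hZ0]; simp only [sub_zero]; exact div_neg_of_neg_of_pos hneg hx0
    rw [← hξ] at h1
    by_contra! h2
    have := a_pos hξ0.le
    have := E_pos ξ
    have : 0 ≤ E ξ / (E ξ + ξ * I ξ) ^ 3 * N ξ := by positivity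
    linarith
  have hNt : ∀ t, ξ ≤ t → N t ≤ 0 := by
    intro t ht
    have ht0 : 0 < t := lt_of_lt_of_le hξ0 ht
    have w1 : 0 ≤ 1 - ξ / t := by rw [sub_nonneg, div_le_one ht0]; exact ht
    have w2 : 0 ≤ ξ / t := by positivity
    have hc := N_concave.2 (Set.self_mem_Ici) (Set.mem_Ici.2 ht0.le) w1 w2 (by ring)
    simp only [smul_eq_mul, N_zero, mul_zero, zero_add] at hc
    rw [div_mul_cancel₀ _ ht0.ne'] at hc
    by_contra! h2
    have : 0 < ξ / t * N t := by positivity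
    linarith
  have hanti : AntitoneOn Z (Set.Ici x) := by
    have h0 : ∀ t ∈ Set.Ici x, 0 ≤ t := fun t ht => hx.trans ht
    apply antitoneOn_of_deriv_nonpos (convex_Ici x)
      (fun t ht => (Z_hasDeriv (h0 t ht)).continuousAt.continuousWithinAt)
      (fun t ht => (Z_hasDeriv (h0 t (interior_subset ht))).differentiableAt.differentiableWithinAt)
    intro t ht
    have ht' := interior_subset ht
    rw [(Z_hasDeriv (h0 t ht')).deriv]
    have := a_pos (h0 t ht')
    have := E_pos t
    exact mul_nonpos_of_nonneg_of_nonpos (by positivity) (hNt t (hξx.le.trans ht'))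
  have hlow : ∀ t, 0 < t → -(1 / (S * t)) ≤ Z t := by
    intro t ht
    have ha := a_pos ht.le
    have hS := S_pos
    have hE := E_pos t
    have hE1 : E t ≤ 1 := by
      unfold E; rw [Real.exp_le_one_iff]; nlinarith [sq_nonneg t]
    have hJ := J_nonneg t
    have hIJ := IJ t
    have h1 : (E t - t * J t) / (E t + t * I t) ≤ 1 / (S * t) := by
      have hb := b_nonneg t
      have hab : S * t ≤ E t + t * I t := by rw [← hIJ]; nlinarith
      have hb1 : E t - t * J t ≤ 1 := by nlinarith
      exact div_le_div₀ (by norm_num) hb1 (by positivity) hab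
    have h2 : 0 ≤ E t / (E t + t * I t) ^ 2 := by positivity
    unfold Z
    linarith
  have hS := S_pos
  set T := max x (2 / (S * (-Z x))) with hT
  have hT0 : 0 < T := lt_of_lt_of_le hx0 (le_max_left _ _)
  have h1 := hlow T hT0
  have h2 : Z T ≤ Z x := hanti Set.self_mem_Ici (Set.mem_Ici.2 (le_max_left _ _)) (le_max_left _ _)
  have h3 : 2 / (S * (-Z x)) ≤ T := le_max_right _ _
  have hz : 0 < -Z x := by linarith
  rw [div_le_iff₀ (by positivity)] at h3
  have h4 : -Z x ≤ 1 / (S * T) := by linarith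
  rw [le_div_iff₀ (by positivity)] at h4
  nlinarith

lemma ab_le_pos {x : ℝ} (hx : 0 ≤ x) : (E x + x * I x) * (E x - x * J x) ≤ E x := by
  have h := Z_nonneg hx
  have ha := a_pos hx
  have : Z x = (E x - (E x + x * I x) * (E x - x * J x)) / (E x + x * I x) ^ 2 := by
    unfold Z; field_simp
  rw [this] at h
  by_contra! h2
  have := div_neg_of_neg_of_pos (sub_neg.2 h2) (pow_pos ha 2)
  linarith

lemma ab_le (x : ℝ) : (E x + x * I x) * (E x - x * J x) ≤ E x := by
  rcases le_total 0 x with hx | hx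
  · exact ab_le_pos hx
  · have := ab_le_pos (x := -x) (by linarith)
    rw [E_neg, ← I_eq, I_eq (-x), neg_neg] at this
    nlinarith

section
variable {k : ℝ → ℝ} (hk : ∀ s t, |k s - k t| ≤ |s - t|)

lemma cont_of (hk : ∀ s t, |k s - k t| ≤ |s - t|) : Continuous k := by
  have : LipschitzWith 1 k := LipschitzWith.of_dist_le_mul fun s t => by
    simpa [Real.dist_eq] using hk s t
  exact this.continuous

lemma kE_int (hk : ∀ s t, |k s - k t| ≤ |s - t|) : Integrable (fun t => k t * E t) := by
  have h1 : Integrable (fun t => |k 0| * E t + |t * E t|) := (E_int.const_mul _).add tE_int.abs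
  refine h1.mono' ((cont_of hk).mul E_cont).aestronglyMeasurable
    (Filter.Eventually.of_forall fun t => ?_)
  rw [Real.norm_eq_abs, abs_mul, abs_mul, abs_of_pos (E_pos t), ← add_mul]
  apply mul_le_mul_of_nonneg_right _ (E_pos t).le
  have h2 := hk t 0
  have h3 := abs_add_le (k t - k 0) (k 0)
  simp only [sub_zero, sub_add_cancel] at h2 h3
  linarith

lemma bound_Ioi (hk : ∀ s t, |k s - k t| ≤ |s - t|) (x : ℝ) :
    |(∫ t in Set.Ioi x, k t * E t) - k x * J x| ≤ E x - x * J x := by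
  have h : (∫ t in Set.Ioi x, k t * E t) - k x * J x = ∫ t in Set.Ioi x, (k t - k x) * E t := by
    simp only [sub_mul]
    rw [integral_sub (kE_int hk).integrableOn (E_int.const_mul _).integrableOn,
      integral_const_mul]
    rfl
  rw [h, ← int_b, ← Real.norm_eq_abs]
  apply norm_integral_le_of_norm_le
  · have : Integrable (fun t => (t - x) * E t) := by
      simp only [sub_mul]
      exact tE_int.sub (E_int.const_mul x)
    exact this.integrableOn
  · refine (ae_restrict_iff' measurableSet_Ioi).2 (Filter.Eventually.of_forall fun t ht => ?_)
    rw [Real.norm_eq_abs, abs_mul, abs_of_pos (E_pos t)]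
    have h2 := hk t x
    have ht' : x < t := ht
    rw [abs_of_pos (sub_pos.2 ht')] at h2
    exact mul_le_mul_of_nonneg_right h2 (E_pos t).le

lemma bound_Iic (hk : ∀ s t, |k s - k t| ≤ |s - t|) (x : ℝ) :
    |(∫ t in Set.Iic x, k t * E t) - k x * I x| ≤ E x + x * I x := by
  have h := bound_Ioi (k := fun t => k (-t)) (fun s t => (hk _ _).trans (by
    rw [abs_sub_comm]; apply le_of_eq; congr 1; ring)) (-x)
  have h2 := integral_comp_neg_Ioi (-x) (fun t => k t * E t)
  simp only [E_neg, neg_neg] at h h2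
  rw [h2, ← I_eq] at h
  linarith

end

lemma abs_comb {A B a b p q : ℝ} (hA : |A| ≤ a) (hB : |B| ≤ b) (hp : 0 ≤ p) (hq : 0 ≤ q) :
    |A * p + B * q| ≤ a * p + b * q := by
  refine (abs_add_le _ _).trans ?_
  rw [abs_mul, abs_mul, abs_of_nonneg hp, abs_of_nonneg hq]
  gcongr

/-- One-dimensional statement. -/
theorem one_dim {k : ℝ → ℝ} (hk : ∀ s t, |k s - k t| ≤ |s - t|) (hd : Differentiable ℝ k)
    (h0 : ∫ t, k t * E t = 0) (f : ℝ → ℝ)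
    (hf : ∀ x, f x = Real.exp (x ^ 2 / 2) * ∫ t in Set.Iic x, k t * E t) :
    Differentiable ℝ f ∧ Differentiable ℝ (deriv f) ∧ (∀ x, deriv f x - x * f x = k x) ∧
      (∀ x, |f x| ≤ 2) ∧ (∀ x, |deriv f x| ≤ √(2 / Real.pi)) ∧
      (∀ x, |deriv (deriv f) x| ≤ 2) := by
  have hEx : ∀ x, Real.exp (x ^ 2 / 2) * E x = 1 := fun x => by
    unfold E; rw [← Real.exp_add, ← Real.exp_zero]; congr 1; ring
  have hexp : ∀ x : ℝ, HasDerivAt (fun x : ℝ => Real.exp (x ^ 2 / 2))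
      (x * Real.exp (x ^ 2 / 2)) x := fun x => by
    have : HasDerivAt (fun t : ℝ => t ^ 2 / 2) x x := by
      have := ((hasDerivAt_id x).pow 2).div_const 2
      refine HasDerivAt.congr_deriv this ?_
      simp
    refine HasDerivAt.congr_deriv this.exp ?_
    ring
  have hder : ∀ x, HasDerivAt f (x * f x + k x) x := fun x => by
    have := (hexp x).mul (prim_hasDeriv ((cont_of hk).mul E_cont) (kE_int hk) x)
    rw [funext hf]
    refine HasDerivAt.congr_deriv this ?_
    have := hEx x
    simp only [Pi.mul_apply]
    linear_combination k x * this
  have hdf : deriv f = fun x => x * f x + k x := funext fun x => (hder x).deriv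
  have hder2 : ∀ x, HasDerivAt (deriv f) (f x + x * (x * f x + k x) + deriv k x) x := fun x => by
    rw [hdf]
    have := ((hasDerivAt_id x).mul (hder x)).add (hd x).hasDerivAt
    refine HasDerivAt.congr_deriv this ?_
    simp
  have hfE : ∀ x, f x * E x = ∫ t in Set.Iic x, k t * E t := fun x => by
    rw [hf]; linear_combination (∫ t in Set.Iic x, k t * E t) * hEx x
  have hA : ∀ x, |f x * E x - k x * I x| ≤ E x + x * I x := fun x => by
    rw [hfE]; exact bound_Iic hk x
  have hB : ∀ x, |f x * E x + k x * J x| ≤ E x - x * J x := fun x => by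
    have h1 := bound_Ioi hk x
    have h2 := intervalIntegral.integral_Iic_add_Ioi (b := x) (kE_int hk).integrableOn
      (kE_int hk).integrableOn
    rw [h0, ← hfE] at h2
    rw [← abs_neg]
    convert h1 using 2
    linarith
  have hS := S_pos
  have key : ∀ x u c, |u * (S * E x)| ≤ c * (S * E x) → |u| ≤ c := fun x u c h => by
    have hE := E_pos x
    rw [abs_mul, abs_of_pos (mul_pos hS hE)] at h
    exact le_of_mul_le_mul_right h (mul_pos hS hE)
  have hf1 : ∀ x, |f x| ≤ 1 := fun x => by
    apply key x
    have h := abs_comb (hA x) (hB x) (J_nonneg x) (I_nonneg x)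
    rw [← IJ x]
    convert h using 1
    · congr 1; ring
    · ring
  refine ⟨fun x => (hder x).differentiableAt, fun x => (hder2 x).differentiableAt,
    fun x => by rw [hdf]; ring, fun x => (hf1 x).trans (by norm_num), fun x => ?_, fun x => ?_⟩
  · have hS2 : √(2 / Real.pi) = 2 / S := by
      have hpi := Real.pi_pos
      rw [eq_div_iff hS.ne', S, ← Real.sqrt_mul (by positivity)]
      have : 2 / Real.pi * (2 * Real.pi) = 2 ^ 2 := by field_simp
      rw [this]; exact Real.sqrt_sq (by norm_num)
    rw [hS2]
    apply key x
    have h := abs_comb ((abs_neg _).trans_le (hA x)) (hB x) (b_nonneg x) (a_nonneg x)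
    have h3 := ab_le x
    have e1 : 2 / S * (S * E x) = 2 * E x := by field_simp
    rw [e1, hdf]
    have e2 : (x * f x + k x) * (S * E x) = -(f x * E x - k x * I x) * (E x - x * J x)
        + (f x * E x + k x * J x) * (E x + x * I x) := by
      rw [← IJ x]; ring
    rw [e2]
    linarith
  · rw [(hder2 x).deriv]
    have hk' : |deriv k x| ≤ 1 := by
      have : ‖deriv k x‖ ≤ 1 := norm_deriv_le_of_lip' (by norm_num)
        (Filter.Eventually.of_forall fun t => by simpa using hk t x)
      exact this
    have h1 : |f x + x * (x * f x + k x)| ≤ 1 := by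
      apply key x
      have h := abs_comb (hA x) (hB x) (mills_J x) (mills_I x)
      rw [← IJ x]
      convert h using 1
      · congr 1; ring
      · ring
    have := abs_add_le (f x + x * (x * f x + k x)) (deriv k x)
    linarith

end SteinAux

/-- properties of the Stein solution `f_h(x,y)` for a `C¹`, 1-Lipschitz
(test) function `h : ℝ × ℝ^d → ℝ`: for each `y`, `x ↦ f_h(x,y)` is twice differentiable,
solves the Stein equation, and satisfies the bounds `|f_h| ≤ 2`, `|∂ₓ f_h| ≤ √(2/π)`,
`|∂²ₓₓ f_h| ≤ 2`. -/
theorem stmt2 (d : ℕ) (hd : 1 ≤ d) (h : ℝ → EuclideanSpace ℝ (Fin d) → ℝ)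
    (hC1 : ContDiff ℝ 1 fun p : ℝ × EuclideanSpace ℝ (Fin d) => h p.1 p.2)
    (hLip : ∀ x x' y y', |h x y - h x' y'| ≤ Real.sqrt ((x - x') ^ 2 + ‖y - y'‖ ^ 2))
    (fh : ℝ → EuclideanSpace ℝ (Fin d) → ℝ)
    (hfh : ∀ x y, fh x y = Real.exp (x ^ 2 / 2) *
      ∫ t in Set.Iio x, (h t y - ∫ z, h z y ∂(gaussianReal 0 1)) * Real.exp (-t ^ 2 / 2)) :
    ∀ y : EuclideanSpace ℝ (Fin d),
      Differentiable ℝ (fun x => fh x y) ∧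
      Differentiable ℝ (deriv fun x => fh x y) ∧
      (∀ x, deriv (fun x' => fh x' y) x - x * fh x y
          = h x y - ∫ z, h z y ∂(gaussianReal 0 1)) ∧
      (∀ x, |fh x y| ≤ 2) ∧
      (∀ x, |deriv (fun x' => fh x' y) x| ≤ Real.sqrt (2 / Real.pi)) ∧
      (∀ x, |deriv (deriv fun x' => fh x' y) x| ≤ 2) := by
  intro y
  have hk0 : ∀ s t, |h s y - h t y| ≤ |s - t| := fun s t => by
    have := hLip s t y y
    simpa [Real.sqrt_sq_eq_abs] using this
  have hdiff : Differentiable ℝ (fun t => h t y) := by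
    have h1 := hC1.differentiable (by norm_num)
    exact h1.comp (differentiable_id.prodMk (differentiable_const y))
  set m := ∫ z, h z y ∂(gaussianReal 0 1) with hm
  have hmS : m * SteinAux.S = ∫ t, h t y * SteinAux.E t := by
    rw [hm, integral_gaussianReal_eq_integral_smul one_ne_zero, ← integral_mul_const]
    apply integral_congr_ae
    refine Filter.Eventually.of_forall fun t => ?_
    have hS := SteinAux.S_pos.ne'
    unfold SteinAux.S at hS
    simp only [gaussianPDFReal_def, SteinAux.S, SteinAux.E, smul_eq_mul, NNReal.coe_one, mul_one,
      sub_zero]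
    field_simp
  have h0 : ∫ t, (h t y - m) * SteinAux.E t = 0 := by
    simp only [sub_mul]
    rw [integral_sub (SteinAux.kE_int hk0) (SteinAux.E_int.const_mul _), integral_const_mul,
      SteinAux.E_total, ← hmS, sub_self]
  exact SteinAux.one_dim (k := fun t => h t y - m) (fun s t => by simpa using hk0 s t)
    (hdiff.sub_const m) h0 (fun x => fh x y)
    (fun x => by rw [hfh, integral_Iic_eq_integral_Iio]; rfl)
end

section
/- Let d ≥ 1 and let X : Ω → ℝ and Y : Ω → ℝ^d be integrable random variables on a probability space. Suppose C ≥ 0 is such that |E[∂_x f(X,Y)] − E[X·f(X,Y)]| ≤ C for every twice differentiable function f : ℝ × ℝ^d → ℝ satisfying ‖f‖_∞ ≤ 2, ‖∂_x f‖_∞ ≤ √(2/π), ‖∂²_{xx} f‖_∞ ≤ 2, and for every j ∈ {1,…,d}, ‖∂_{y_j} f‖_∞ ≤ √(2π) and ‖∂_x ∂_{y_j} f‖_∞ ≤ 4. Then for every Lipschitz function h : ℝ × ℝ^d → ℝ with Lip(h) ≤ 1 one has |E[h(X,Y)] − ∫_ℝ E[h(z,Y)] γ(dz)| ≤ C; in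 other words, d_Wass((X,Y),(Z',Y)) ≤ C where Z' ∼ N(0,1) is independent of Y. -/
open MeasureTheory ProbabilityTheory

/-! ### One-dimensional Gaussian facts -/

lemma stein_pdf (x : ℝ) :
    gaussianPDFReal 0 1 x = (Real.sqrt (2 * Real.pi))⁻¹ * Real.exp (-x ^ 2 / 2) := by
  simp [gaussianPDFReal]

lemma stein_pdf_deriv (x : ℝ) :
    HasDerivAt (gaussianPDFReal 0 1) (-x * gaussianPDFReal 0 1 x) x := by
  have e : gaussianPDFReal 0 1
      = fun x => (Real.sqrt (2 * Real.pi))⁻¹ * Real.exp (-x ^ 2 / 2) := funext stein_pdf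
  rw [e]
  have h1 : HasDerivAt (fun x : ℝ => -x ^ 2 / 2) (-x) x := by
    have := ((hasDerivAt_pow 2 x).neg).div_const 2
    convert! this using 1
    simp; ring
  convert! (h1.exp).const_mul ((Real.sqrt (2 * Real.pi))⁻¹) using 1
  ring

lemma stein_integrable_id : Integrable (fun z : ℝ => z) (gaussianReal 0 1) := by
  have := (memLp_id_gaussianReal (μ := 0) (v := 1) 1)
  have h2 : MemLp id 1 (gaussianReal 0 1) := by simpa using this
  exact memLp_one_iff_integrable.1 h2

lemma stein_integrable_pdf_mul : Integrable (fun z : ℝ => gaussianPDFReal 0 1 z * z) := by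
  have h : Integrable (fun x : ℝ => x * Real.exp (-(1/2 : ℝ) * x ^ 2)) :=
    integrable_mul_exp_neg_mul_sq (by norm_num)
  refine (h.const_mul ((Real.sqrt (2 * Real.pi))⁻¹)).congr (Filter.Eventually.of_forall fun x => ?_)
  simp only [stein_pdf]
  rw [show -x ^ 2 / 2 = -(1/2 : ℝ) * x ^ 2 by ring]
  ring

lemma stein_integral_abs : ∫ z, |z| ∂(gaussianReal 0 1) = Real.sqrt (2 / Real.pi) := by
  rw [integral_gaussianReal_eq_integral_smul (by norm_num)]
  have e : (fun x : ℝ => gaussianPDFReal 0 1 x • |x|)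
      = fun x : ℝ => (fun t : ℝ => gaussianPDFReal 0 1 t * t) |x| := by
    funext x
    simp [stein_pdf]
  rw [e, integral_comp_abs (f := fun t : ℝ => gaussianPDFReal 0 1 t * t)]
  have hd : ∀ x ∈ Set.Ici (0 : ℝ), HasDerivAt (fun x => - gaussianPDFReal 0 1 x)
      (gaussianPDFReal 0 1 x * x) x := by
    intro x _
    convert! (stein_pdf_deriv x).neg using 1
    ring
  have ht : Filter.Tendsto (fun x => - gaussianPDFReal 0 1 x) Filter.atTop (nhds (-0)) := by
    apply Filter.Tendsto.neg
    have e : gaussianPDFReal 0 1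
      = fun x => (Real.sqrt (2 * Real.pi))⁻¹ * Real.exp (-x ^ 2 / 2) := funext stein_pdf
    rw [e, ← mul_zero ((Real.sqrt (2 * Real.pi))⁻¹)]
    apply Filter.Tendsto.const_mul
    apply Real.tendsto_exp_atBot.comp
    have h2 : Filter.Tendsto (fun x : ℝ => x ^ 2) Filter.atTop Filter.atTop :=
      Filter.tendsto_pow_atTop (by norm_num)
    have := (h2.const_mul_atTop (show (0:ℝ) < 1/2 by norm_num))
    have := Filter.tendsto_neg_atTop_atBot.comp this
    refine this.congr fun x => ?_
    simp; ring
  rw [integral_Ioi_of_hasDerivAt_of_tendsto' hd stein_integrable_pdf_mul.integrableOn ht]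
  rw [stein_pdf]
  have hp := Real.pi_pos
  have e2 : Real.sqrt (2 / Real.pi) = 2 * (Real.sqrt (2 * Real.pi))⁻¹ := by
    rw [← Real.sqrt_inv, show (2 / Real.pi) = 2 ^ 2 * (2 * Real.pi)⁻¹ by field_simp,
      Real.sqrt_mul (by norm_num : (0 : ℝ) ≤ 2 ^ 2), Real.sqrt_sq (by norm_num)]
  rw [e2]
  simp

lemma stein_ibp (g g' : ℝ → ℝ) (K : ℝ) (hg : ∀ x, HasDerivAt g (g' x) x)
    (hgb : ∀ x, |g x| ≤ K) (hc : Continuous g') (hgb' : ∀ x, |g' x| ≤ K) :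
    ∫ z, z * g z ∂(gaussianReal 0 1) = ∫ z, g' z ∂(gaussianReal 0 1) := by
  have hgc : Continuous g := continuous_iff_continuousAt.2 fun x => (hg x).continuousAt
  have hp : Integrable (gaussianPDFReal 0 1) := integrable_gaussianPDFReal 0 1
  have i1 : Integrable (fun x => gaussianPDFReal 0 1 x * g x) :=
    hp.mul_bdd (c := K) hgc.aestronglyMeasurable (Filter.Eventually.of_forall hgb)
  have i2 : Integrable (fun x => gaussianPDFReal 0 1 x * g' x) :=
    hp.mul_bdd (c := K) hc.aestronglyMeasurable (Filter.Eventually.of_forall hgb')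
  have i3 : Integrable (fun x => (gaussianPDFReal 0 1 x * x) * g x) :=
    stein_integrable_pdf_mul.mul_bdd (c := K) hgc.aestronglyMeasurable (Filter.Eventually.of_forall hgb)
  have h0 := integral_eq_zero_of_hasDerivAt_of_integrable
    (f := fun x => gaussianPDFReal 0 1 x * g x)
    (f' := fun x => gaussianPDFReal 0 1 x * g' x - (gaussianPDFReal 0 1 x * x) * g x)
    (fun x => by
      convert! (stein_pdf_deriv x).mul (hg x) using 1
      ring) (i2.sub i3) i1
  rw [integral_sub i2 i3] at h0
  rw [integral_gaussianReal_eq_integral_smul (by norm_num),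
    integral_gaussianReal_eq_integral_smul (by norm_num)]
  simp only [smul_eq_mul]
  rw [sub_eq_zero.1 h0]
  congr 1
  funext x
  ring

lemma stein_ibp_affine (g g' : ℝ → ℝ) (K a b : ℝ) (hg : ∀ x, HasDerivAt g (g' x) x)
    (hgb : ∀ x, |g x| ≤ K) (hc : Continuous g') (hgb' : ∀ x, |g' x| ≤ K) :
    ∫ z, z * g (a + b * z) ∂(gaussianReal 0 1)
      = b * ∫ z, g' (a + b * z) ∂(gaussianReal 0 1) := by
  rw [← integral_const_mul]
  have hK : 0 ≤ K := (abs_nonneg _).trans (hgb 0)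
  apply stein_ibp (fun z => g (a + b * z)) (fun z => b * g' (a + b * z)) (max K (|b| * K))
  · intro x
    have h1 : HasDerivAt (fun z : ℝ => a + b * z) b x := by
      simpa using ((hasDerivAt_id x).const_mul b).const_add a
    convert! (hg (a + b * x)).comp x h1 using 1
    ring
  · intro x; exact (hgb _).trans (le_max_left _ _)
  · fun_prop
  · intro x
    rw [abs_mul]
    exact (mul_le_mul_of_nonneg_left (hgb' _) (abs_nonneg _)).trans (le_max_right _ _)

/-- pointwise smoothing bound -/
lemma stein_smooth_bound (g g' : ℝ → ℝ) (K B a b : ℝ) (hb : 0 < b)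
    (hg : ∀ x, HasDerivAt g (g' x) x)
    (hgb : ∀ x, |g x| ≤ K) (hc : Continuous g') (hgb' : ∀ x, |g' x| ≤ K)
    (hB : ∀ x, |g x| ≤ B) :
    |∫ z, g' (a + b * z) ∂(gaussianReal 0 1)| ≤ B * Real.sqrt (2 / Real.pi) * b⁻¹ := by
  have h := stein_ibp_affine g g' K a b hg hgb hc hgb'
  have hgc : Continuous g := continuous_iff_continuousAt.2 fun x => (hg x).continuousAt
  have h1 : |∫ z, z * g (a + b * z) ∂(gaussianReal 0 1)| ≤ B * Real.sqrt (2 / Real.pi) := by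
    rw [← stein_integral_abs, ← integral_const_mul, ← Real.norm_eq_abs]
    refine norm_integral_le_of_norm_le (stein_integrable_id.abs.const_mul B)
      (Filter.Eventually.of_forall fun z => ?_)
    rw [Real.norm_eq_abs, abs_mul, mul_comm]
    exact mul_le_mul_of_nonneg_right (hB _) (abs_nonneg _)
  rw [h, abs_mul, abs_of_pos hb] at h1
  rw [← div_eq_mul_inv, le_div_iff₀ hb]
  linarith

/-! ### Comparison principle -/

lemma stein_cmp_right (q q' : ℝ → ℝ) (x0 M : ℝ) (hq : ∀ x, HasDerivAt q (q' x) x)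
    (hqb : ∀ x, |q x| ≤ M) (hpos : ∀ x, x0 < x → 0 ≤ q' x - x * q x) : q x0 ≤ 0 := by
  have hd : ∀ x, HasDerivAt (fun x => gaussianPDFReal 0 1 x * q x)
      (gaussianPDFReal 0 1 x * (q' x - x * q x)) x := fun x => by
    convert! (stein_pdf_deriv x).mul (hq x) using 1
    ring
  have hmono : MonotoneOn (fun x => gaussianPDFReal 0 1 x * q x) (Set.Ici x0) := by
    apply monotoneOn_of_hasDerivWithinAt_nonneg (convex_Ici x0)
      (fun x _ => (hd x).continuousAt.continuousWithinAt)
      (fun x _ => (hd x).hasDerivWithinAt)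
    intro x hx
    rw [interior_Ici] at hx
    exact mul_nonneg (gaussianPDFReal_nonneg _ _ _) (hpos x hx)
  have ht : Filter.Tendsto (fun x => gaussianPDFReal 0 1 x * M) Filter.atTop (nhds 0) := by
    have e : gaussianPDFReal 0 1
      = fun x => (Real.sqrt (2 * Real.pi))⁻¹ * Real.exp (-x ^ 2 / 2) := funext stein_pdf
    rw [e, ← zero_mul M, ← mul_zero ((Real.sqrt (2 * Real.pi))⁻¹)]
    apply Filter.Tendsto.mul_const
    apply Filter.Tendsto.const_mul
    apply Real.tendsto_exp_atBot.comp
    have h2 : Filter.Tendsto (fun x : ℝ => x ^ 2) Filter.atTop Filter.atTop :=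
      Filter.tendsto_pow_atTop (by norm_num)
    have := (h2.const_mul_atTop (show (0:ℝ) < 1/2 by norm_num))
    have := Filter.tendsto_neg_atTop_atBot.comp this
    refine this.congr fun x => ?_
    simp; ring
  have hle : gaussianPDFReal 0 1 x0 * q x0 ≤ 0 := by
    refine ge_of_tendsto ht ?_
    filter_upwards [Filter.eventually_ge_atTop x0] with x hx
    refine (hmono (Set.mem_Ici.2 le_rfl) hx hx).trans ?_
    exact mul_le_mul_of_nonneg_left ((le_abs_self _).trans (hqb x)) (gaussianPDFReal_nonneg _ _ _)
  by_contra! hcon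
  have := mul_pos (gaussianPDFReal_pos 0 1 x0 (by norm_num)) hcon
  linarith

lemma stein_cmp_left (q q' : ℝ → ℝ) (x0 M : ℝ) (hq : ∀ x, HasDerivAt q (q' x) x)
    (hqb : ∀ x, |q x| ≤ M) (hneg : ∀ x, x < x0 → q' x - x * q x ≤ 0) : q x0 ≤ 0 := by
  have := stein_cmp_right (fun x => q (-x)) (fun x => - q' (-x)) (-x0) M
    (fun x => by
      have := (hq (-x)).comp x (hasDerivAt_neg x)
      convert! this using 1
      ring) (fun x => hqb _) (fun x hx => by
      have := hneg (-x) (by linarith)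
      linarith)
  simpa using this

/-- Mills-type bound. -/
lemma stein_mills (F r : ℝ → ℝ) (K M : ℝ) (hF : ∀ x, HasDerivAt F (x * F x + r x) x)
    (hFb : ∀ x, |F x| ≤ M) (hr : ∀ x, |r x| ≤ K) (x : ℝ) : |x * F x| ≤ K := by
  have hK : 0 ≤ K := (abs_nonneg _).trans (hr 0)
  have key : ∀ (F r : ℝ → ℝ), (∀ x, HasDerivAt F (x * F x + r x) x) → (∀ x, |F x| ≤ M) →
      (∀ x, |r x| ≤ K) → ∀ x, 0 < x → x * F x ≤ K := by
    intro F r hF hFb hr x hx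
    have := stein_cmp_right (fun t => F t - K / x) (fun t => t * F t + r t) x (M + |K / x|)
      (fun t => (hF t).sub_const _)
      (fun t => (abs_sub _ _).trans (by have := hFb t; linarith)) (fun t ht => by
        have h1 := (abs_le.1 (hr t)).1
        have h2 : K ≤ t * (K / x) := by
          rw [mul_div_assoc', le_div_iff₀ hx]
          nlinarith
        nlinarith)
    have h3 : F x ≤ K / x := by linarith
    rw [le_div_iff₀ hx] at h3
    linarith
  have key2 : ∀ (F r : ℝ → ℝ), (∀ x, HasDerivAt F (x * F x + r x) x) → (∀ x, |F x| ≤ M) →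
      (∀ x, |r x| ≤ K) → ∀ x, 0 < x → |x * F x| ≤ K := by
    intro F r hF hFb hr x hx
    have h1 := key F r hF hFb hr x hx
    have h2 := key (fun x => - F x) (fun x => - r x)
      (fun x => by convert! (hF x).neg using 1; ring) (by simpa using hFb) (by simpa using hr) x hx
    rw [abs_le]
    constructor <;> linarith
  rcases lt_trichotomy x 0 with hx | hx | hx
  · have := key2 (fun x => F (-x)) (fun x => - r (-x)) (fun x => by
      have := (hF (-x)).comp x (hasDerivAt_neg x)
      convert! this using 1
      ring) (fun x => hFb _) (fun x => by simpa using hr _) (-x) (by linarith)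
    simpa using this
  · simpa [hx] using hK
  · exact key2 F r hF hFb hr x hx

lemma stein_mono_aux (F H : ℝ → ℝ) (M : ℝ) (hF : ∀ x, HasDerivAt F (x * F x + H x) x)
    (hFb : ∀ x, |F x| ≤ M) (hH : Monotone H) (x : ℝ) (hx : 0 ≤ x) :
    (1 + x ^ 2) * F x + x * H x ≤ 0 := by
  rcases le_total (H x) 0 with h0 | h0
  · have : F x ≤ 0 := stein_cmp_left F _ x M hF hFb (fun t ht => by
      have := hH ht.le
      linarith)
    nlinarith [sq_nonneg x]
  · have hpos : ∀ t : ℝ, 0 < 1 + t ^ 2 := fun t => by positivity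
    have := stein_cmp_right (fun t => F t + H x * (t / (1 + t ^ 2)))
      (fun t => t * F t + H t + H x * ((1 * (1 + t ^ 2) - t * (2 * t)) / (1 + t ^ 2) ^ 2)) x
      (M + |H x|)
      (fun t => by
        have h2 : HasDerivAt (fun t : ℝ => 1 + t ^ 2) (2 * t) t := by
          simpa using (hasDerivAt_pow 2 t).const_add 1
        exact (hF t).add (((hasDerivAt_id t).div h2 (hpos t).ne').const_mul (H x)))
      (fun t => by
        refine (abs_add_le _ _).trans (add_le_add (hFb t) ?_)
        rw [abs_mul]
        refine mul_le_of_le_one_right (abs_nonneg _) ?_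
        rw [abs_div, abs_of_pos (hpos t), div_le_one (hpos t)]
        rw [← sq_abs t]
        nlinarith [sq_nonneg (|t| - 1), abs_nonneg t])
      (fun t ht => by
        have h1 := hH ht.le
        have h2 : (1 * (1 + t ^ 2) - t * (2 * t)) / (1 + t ^ 2) ^ 2 - t * (t / (1 + t ^ 2)) ≥ -1 := by
          have : (1 * (1 + t ^ 2) - t * (2 * t)) / (1 + t ^ 2) ^ 2 - t * (t / (1 + t ^ 2)) + 1
              = 2 / (1 + t ^ 2) ^ 2 := by
            field_simp
            ring
          have h3 : 0 ≤ 2 / (1 + t ^ 2) ^ 2 := by positivity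
          linarith
        nlinarith)
    have h5 : (1 + x ^ 2) * (F x + H x * (x / (1 + x ^ 2))) ≤ 0 :=
      mul_nonpos_of_nonneg_of_nonpos (hpos x).le this
    have h6 : (1 + x ^ 2) * (F x + H x * (x / (1 + x ^ 2))) = (1 + x ^ 2) * F x + x * H x := by
      field_simp
    linarith

lemma stein_mono (F H : ℝ → ℝ) (M : ℝ) (hF : ∀ x, HasDerivAt F (x * F x + H x) x)
    (hFb : ∀ x, |F x| ≤ M) (hH : Monotone H) (x : ℝ) :
    (1 + x ^ 2) * F x + x * H x ≤ 0 := by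
  rcases le_total 0 x with hx | hx
  · exact stein_mono_aux F H M hF hFb hH x hx
  · have := stein_mono_aux (fun x => F (-x)) (fun x => - H (-x)) M (fun x => by
      have := (hF (-x)).comp x (hasDerivAt_neg x)
      convert! this using 1
      ring) (fun x => hFb _) (fun a b hab => by
        have := hH (neg_le_neg hab)
        simpa using this) (-x) (by linarith)
    simpa using this

/-- second derivative bound -/
lemma stein_second (F H G : ℝ → ℝ) (M : ℝ) (hF : ∀ x, HasDerivAt F (x * F x + H x) x)
    (hFb : ∀ x, |F x| ≤ M) (hH : ∀ x, HasDerivAt H (G x) x) (hG : ∀ x, |G x| ≤ 1) (x : ℝ) :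
    |F x + x * (x * F x + H x) + G x| ≤ 2 := by
  have h1 := stein_mono (fun x => F x - 1) (fun x => H x + x) (M + 1)
    (fun x => by convert! (hF x).sub_const 1 using 1; ring)
    (fun x => (abs_sub _ _).trans (by simpa using hFb x))
    (monotone_of_hasDerivAt_nonneg (fun x => (hH x).add (hasDerivAt_id x))
      (fun x => by have := (abs_le.1 (hG x)).1; simp; linarith)) x
  have h2 := stein_mono (fun x => -1 - F x) (fun x => x - H x) (M + 1)
    (fun x => by convert! (hF x).const_sub (-1) using 1; ring)
    (fun x => (abs_sub _ _).trans (by have := hFb x; simp; linarith))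
    (monotone_of_hasDerivAt_nonneg (fun x => (hasDerivAt_id x).sub (hH x))
      (fun x => by have := (abs_le.1 (hG x)).2; simp; linarith)) x
  have h3 := abs_le.1 (hG x)
  rw [abs_le]
  constructor <;> nlinarith

/-! ### The one-dimensional Stein solution -/

/-- the interpolation measure -/
noncomputable def steinMu : Measure (ℝ × ℝ) :=
  (volume.restrict (Set.Ioo (0 : ℝ) 1)).prod (gaussianReal 0 1)

instance steinMu_prob : IsProbabilityMeasure steinMu := by
  have : IsProbabilityMeasure (volume.restrict (Set.Ioo (0 : ℝ) 1)) := ⟨by simp⟩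
  unfold steinMu
  infer_instance

lemma steinMu_ae : ∀ᵐ ω ∂steinMu, ω.1 ∈ Set.Ioo (0 : ℝ) 1 := by
  have h : ∀ᵐ s ∂(volume.restrict (Set.Ioo (0 : ℝ) 1)), s ∈ Set.Ioo (0 : ℝ) 1 :=
    ae_restrict_mem measurableSet_Ioo
  exact Measure.quasiMeasurePreserving_fst.ae h

lemma stein_integrable_bdd {F : Type*} [NormedAddCommGroup F] (k : ℝ × ℝ → F) (K : ℝ)
    (hk : Continuous k) (hb : ∀ ω : ℝ × ℝ, ω.1 ∈ Set.Ioo (0 : ℝ) 1 → ‖k ω‖ ≤ K) :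
    Integrable k steinMu := by
  refine Integrable.of_bound hk.aestronglyMeasurable K ?_
  filter_upwards [steinMu_ae] with ω hω using hb ω hω

lemma stein_lip (H G : ℝ → ℝ) (K : ℝ) (hH : ∀ x, HasDerivAt H (G x) x) (hG : ∀ x, |G x| ≤ K)
    (x y : ℝ) : |H x - H y| ≤ K * |x - y| := by
  have := Convex.norm_image_sub_le_of_norm_hasDerivWithin_le (f := H) (f' := G) (s := Set.univ)
    (C := K) (x := y) (y := x) (fun t _ => (hH t).hasDerivWithinAt) (fun t _ => hG t) convex_univ
    trivial trivial
  simpa using this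

lemma stein_interp (H G G' : ℝ → ℝ) (K : ℝ) (hH : ∀ x, HasDerivAt H (G x) x)
    (hG : ∀ x, HasDerivAt G (G' x) x) (hGc : Continuous G') (hGb : ∀ x, |G x| ≤ K)
    (hGb' : ∀ x, |G' x| ≤ K) (x : ℝ) (s : ℝ) (hs : s ∈ Set.Ioo (0 : ℝ) 1) :
    HasDerivAt (fun s : ℝ => ∫ z, H (s * x + Real.sqrt (1 - s ^ 2) * z) ∂(gaussianReal 0 1))
      (x * (∫ z, G (s * x + Real.sqrt (1 - s ^ 2) * z) ∂(gaussianReal 0 1))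
        - s * ∫ z, G' (s * x + Real.sqrt (1 - s ^ 2) * z) ∂(gaussianReal 0 1)) s := by
  have hK : 0 ≤ K := (abs_nonneg _).trans (hGb 0)
  have hHc : Continuous H := continuous_iff_continuousAt.2 fun x => (hH x).continuousAt
  have hGc0 : Continuous G := continuous_iff_continuousAt.2 fun x => (hG x).continuousAt
  have hIG : Integrable (fun z => G (s * x + Real.sqrt (1 - s ^ 2) * z)) (gaussianReal 0 1) :=
    Integrable.of_bound (by fun_prop) K (Filter.Eventually.of_forall fun z => hGb _)
  have hIzG : Integrable (fun z => z * G (s * x + Real.sqrt (1 - s ^ 2) * z))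
      (gaussianReal 0 1) :=
    stein_integrable_id.mul_bdd (c := K) (by fun_prop) (Filter.Eventually.of_forall fun z => hGb _)
  obtain ⟨hs0, hs1⟩ := hs
  set r := (1 + s) / 2 with hr
  have hr1 : r < 1 := by linarith
  have hr0 : 0 < r := by linarith
  have hrpos : 0 < 1 - r ^ 2 := by nlinarith
  set c := (Real.sqrt (1 - r ^ 2))⁻¹ with hc
  have hcpos : 0 < c := by positivity
  have hder := (hasDerivAt_integral_of_dominated_loc_of_deriv_le (μ := gaussianReal 0 1)
    (F := fun (s : ℝ) (z : ℝ) => H (s * x + Real.sqrt (1 - s ^ 2) * z))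
    (F' := fun (s : ℝ) (z : ℝ) => G (s * x + Real.sqrt (1 - s ^ 2) * z) *
      (x - s / Real.sqrt (1 - s ^ 2) * z)) (x₀ := s) (s := Set.Ioo 0 r)
    (bound := fun z => K * (|x| + c * |z|)) (Ioo_mem_nhds hs0 (by linarith))
    (Filter.Eventually.of_forall fun s => by
      apply Continuous.aestronglyMeasurable; fun_prop) ?_ ?_ ?_ ?_ ?_).2
  · convert! hder using 1
    have h1 := stein_ibp_affine G G' K (s * x) (Real.sqrt (1 - s ^ 2)) hG hGb hGc hGb'
    have hb : 0 < Real.sqrt (1 - s ^ 2) := Real.sqrt_pos.2 (by nlinarith)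
    have e : (fun z => G (s * x + Real.sqrt (1 - s ^ 2) * z) *
      (x - s / Real.sqrt (1 - s ^ 2) * z)) = fun z => x * G (s * x + Real.sqrt (1 - s ^ 2) * z)
        - s / Real.sqrt (1 - s ^ 2) * (z * G (s * x + Real.sqrt (1 - s ^ 2) * z)) := by
      funext z; ring
    rw [e, integral_sub (hIG.const_mul _) (hIzG.const_mul _), integral_const_mul,
      integral_const_mul, h1]
    field_simp
  · have hi : Integrable (fun z : ℝ => |H (s * x)| + K * Real.sqrt (1 - s ^ 2) * |z|)
        (gaussianReal 0 1) := (integrable_const _).add (stein_integrable_id.abs.const_mul _)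
    refine hi.mono' (by fun_prop) (Filter.Eventually.of_forall fun z => ?_)
    have h1 := stein_lip H G K hH hGb (s * x + Real.sqrt (1 - s ^ 2) * z) (s * x)
    rw [add_sub_cancel_left, abs_mul, abs_of_nonneg (Real.sqrt_nonneg _)] at h1
    have h2 := abs_sub_abs_le_abs_sub (H (s * x + Real.sqrt (1 - s ^ 2) * z)) (H (s * x))
    rw [Real.norm_eq_abs]
    linarith
  · apply Continuous.aestronglyMeasurable; fun_prop
  · refine Filter.Eventually.of_forall fun z t ht => ?_
    obtain ⟨ht0, ht1⟩ := ht
    rw [Real.norm_eq_abs, abs_mul]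
    refine mul_le_mul (hGb _) ?_ (abs_nonneg _) hK
    refine (abs_sub _ _).trans ?_
    rw [abs_mul, abs_div, abs_of_pos ht0, abs_of_nonneg (Real.sqrt_nonneg _)]
    gcongr
    rw [hc, div_eq_mul_inv]
    have hle : Real.sqrt (1 - r ^ 2) ≤ Real.sqrt (1 - t ^ 2) := Real.sqrt_le_sqrt (by nlinarith)
    have h3 : (Real.sqrt (1 - t ^ 2))⁻¹ ≤ (Real.sqrt (1 - r ^ 2))⁻¹ :=
      inv_anti₀ (Real.sqrt_pos.2 hrpos) hle
    have h4 : 0 ≤ (Real.sqrt (1 - t ^ 2))⁻¹ := by positivity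
    nlinarith
  · exact (((integrable_const _).add (stein_integrable_id.abs.const_mul _))).const_mul _
  · refine Filter.Eventually.of_forall fun z t ht => ?_
    obtain ⟨ht0, ht1⟩ := ht
    have hpos : 0 < 1 - t ^ 2 := by nlinarith
    have h1 : HasDerivAt (fun t : ℝ => 1 - t ^ 2) (-(2 * t)) t := by
      simpa using (hasDerivAt_pow 2 t).const_sub 1
    have h2 := h1.sqrt hpos.ne'
    have h3 : HasDerivAt (fun t : ℝ => t * x + Real.sqrt (1 - t ^ 2) * z)
        (x - t / Real.sqrt (1 - t ^ 2) * z) t := by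
      convert! ((hasDerivAt_id t).mul_const x).add (h2.mul_const z) using 1
      have hb : 0 < Real.sqrt (1 - t ^ 2) := Real.sqrt_pos.2 hpos
      field_simp
      ring
    exact (hH _).comp t h3

lemma stein_identity (H G G' : ℝ → ℝ) (K : ℝ) (hH : ∀ x, HasDerivAt H (G x) x)
    (hG : ∀ x, HasDerivAt G (G' x) x) (hGc : Continuous G') (hGb : ∀ x, |G x| ≤ K)
    (hGb' : ∀ x, |G' x| ≤ K) (x : ℝ) :
    x * (∫ ω, G (ω.1 * x + Real.sqrt (1 - ω.1 ^ 2) * ω.2) ∂steinMu)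
      - ∫ ω, ω.1 * G' (ω.1 * x + Real.sqrt (1 - ω.1 ^ 2) * ω.2) ∂steinMu
      = H x - ∫ z, H z ∂(gaussianReal 0 1) := by
  have hK : 0 ≤ K := (abs_nonneg _).trans (hGb 0)
  have hHc : Continuous H := continuous_iff_continuousAt.2 fun x => (hH x).continuousAt
  have hGc0 : Continuous G := continuous_iff_continuousAt.2 fun x => (hG x).continuousAt
  have i1 : Integrable (fun ω : ℝ × ℝ => G (ω.1 * x + Real.sqrt (1 - ω.1 ^ 2) * ω.2)) steinMu :=
    stein_integrable_bdd _ K (by fun_prop) (fun ω _ => hGb _)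
  have i2 : Integrable
      (fun ω : ℝ × ℝ => ω.1 * G' (ω.1 * x + Real.sqrt (1 - ω.1 ^ 2) * ω.2)) steinMu :=
    stein_integrable_bdd _ K (by fun_prop) (fun ω hω => by
      rw [norm_mul, Real.norm_eq_abs, abs_of_pos hω.1, Real.norm_eq_abs]
      have := hGb' (ω.1 * x + Real.sqrt (1 - ω.1 ^ 2) * ω.2)
      have := abs_nonneg (G' (ω.1 * x + Real.sqrt (1 - ω.1 ^ 2) * ω.2))
      have := hω.2
      nlinarith)
  have i3 := i1.const_mul x |>.sub i2
  have hu := fun s hs => stein_interp H G G' K hH hG hGc hGb hGb' x s hs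
  have hcont : ContinuousOn
      (fun s : ℝ => ∫ z, H (s * x + Real.sqrt (1 - s ^ 2) * z) ∂(gaussianReal 0 1))
      (Set.Icc 0 1) := by
    apply continuousOn_of_dominated (bound := fun z => |H 0| + K * (|x| + |z|))
    · intro s _; apply Continuous.aestronglyMeasurable; fun_prop
    · intro s hs
      refine Filter.Eventually.of_forall fun z => ?_
      have h1 := stein_lip H G K hH hGb (s * x + Real.sqrt (1 - s ^ 2) * z) 0
      have h2 := abs_sub_abs_le_abs_sub (H (s * x + Real.sqrt (1 - s ^ 2) * z)) (H 0)
      have h3 : |s * x + Real.sqrt (1 - s ^ 2) * z| ≤ |x| + |z| := by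
        refine (abs_add_le _ _).trans (add_le_add ?_ ?_)
        · rw [abs_mul, abs_of_nonneg hs.1]
          exact mul_le_of_le_one_left (abs_nonneg _) hs.2
        · rw [abs_mul, abs_of_nonneg (Real.sqrt_nonneg _)]
          refine mul_le_of_le_one_left (abs_nonneg _) ?_
          exact Real.sqrt_le_iff.2 ⟨by norm_num, by nlinarith [sq_nonneg s]⟩
      rw [sub_zero] at h1
      have h4 := mul_le_mul_of_nonneg_left h3 hK
      rw [Real.norm_eq_abs]
      linarith
    · exact (integrable_const _).add
        (((integrable_const _).add stein_integrable_id.abs).const_mul _)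
    · refine Filter.Eventually.of_forall fun z => ?_
      apply Continuous.continuousOn; fun_prop
  have i4 := i3.integral_prod_left
  have e4 : ∀ s : ℝ, (∫ z, ((fun ω : ℝ × ℝ => x * G (ω.1 * x + Real.sqrt (1 - ω.1 ^ 2) * ω.2)) -
      (fun ω : ℝ × ℝ => ω.1 * G' (ω.1 * x + Real.sqrt (1 - ω.1 ^ 2) * ω.2))) (s, z)
        ∂(gaussianReal 0 1))
      = x * (∫ z, G (s * x + Real.sqrt (1 - s ^ 2) * z) ∂(gaussianReal 0 1))
        - s * ∫ z, G' (s * x + Real.sqrt (1 - s ^ 2) * z) ∂(gaussianReal 0 1) := by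
    intro s
    rw [← integral_const_mul, ← integral_const_mul]
    rw [← integral_sub]
    · rfl
    · exact (Integrable.of_bound (by fun_prop) K
        (Filter.Eventually.of_forall fun z => hGb _)).const_mul x
    · exact (Integrable.of_bound (by fun_prop) K
        (Filter.Eventually.of_forall fun z => hGb' _)).const_mul s
  have hftc := intervalIntegral.integral_eq_sub_of_hasDerivAt_of_le zero_le_one hcont hu (by
    rw [intervalIntegrable_iff_integrableOn_Ioo_of_le zero_le_one]
    exact i4.congr (Filter.Eventually.of_forall e4))
  rw [intervalIntegral.integral_of_le zero_le_one, integral_Ioc_eq_integral_Ioo] at hftc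
  rw [← integral_const_mul, ← integral_sub (i1.const_mul x) i2]
  have := integral_prod _ i3
  simp only [e4] at this
  rw [hftc] at this
  simpa [steinMu] using this

lemma stein_hasDeriv (G G' : ℝ → ℝ) (K : ℝ)
    (hG : ∀ x, HasDerivAt G (G' x) x) (hGc : Continuous G') (hGb : ∀ x, |G x| ≤ K)
    (hGb' : ∀ x, |G' x| ≤ K) (x : ℝ) :
    HasDerivAt (fun x => ∫ ω, G (ω.1 * x + Real.sqrt (1 - ω.1 ^ 2) * ω.2) ∂steinMu)
      (∫ ω, ω.1 * G' (ω.1 * x + Real.sqrt (1 - ω.1 ^ 2) * ω.2) ∂steinMu) x := by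
  have hGc0 : Continuous G := continuous_iff_continuousAt.2 fun x => (hG x).continuousAt
  refine (hasDerivAt_integral_of_dominated_loc_of_deriv_le (μ := steinMu)
    (F := fun (x : ℝ) (ω : ℝ × ℝ) => G (ω.1 * x + Real.sqrt (1 - ω.1 ^ 2) * ω.2))
    (F' := fun (x : ℝ) (ω : ℝ × ℝ) => ω.1 * G' (ω.1 * x + Real.sqrt (1 - ω.1 ^ 2) * ω.2))
    (x₀ := x) (s := Set.univ) (bound := fun _ => K) Filter.univ_mem
    (Filter.Eventually.of_forall fun s => by
      apply Continuous.aestronglyMeasurable; fun_prop) ?_ ?_ ?_ ?_ ?_).2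
  · exact stein_integrable_bdd _ K (by fun_prop) (fun ω _ => hGb _)
  · apply Continuous.aestronglyMeasurable; fun_prop
  · filter_upwards [steinMu_ae] with ω hω x _
    rw [norm_mul, Real.norm_eq_abs, abs_of_pos hω.1, Real.norm_eq_abs]
    have := hGb' (ω.1 * x + Real.sqrt (1 - ω.1 ^ 2) * ω.2)
    have := abs_nonneg (G' (ω.1 * x + Real.sqrt (1 - ω.1 ^ 2) * ω.2))
    have := hω.2
    nlinarith
  · exact integrable_const _
  · refine Filter.Eventually.of_forall fun ω x _ => ?_
    have h1 : HasDerivAt (fun x : ℝ => ω.1 * x + Real.sqrt (1 - ω.1 ^ 2) * ω.2) ω.1 x := by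
      simpa using ((hasDerivAt_id x).const_mul ω.1).add_const (Real.sqrt (1 - ω.1 ^ 2) * ω.2)
    convert! (hG _).comp x h1 using 1
    ring

lemma stein_int1 : IntegrableOn (fun s : ℝ => s * (Real.sqrt (1 - s ^ 2))⁻¹) (Set.Ioo 0 1) ∧
    ∫ s in Set.Ioo (0 : ℝ) 1, s * (Real.sqrt (1 - s ^ 2))⁻¹ = 1 := by
  have hc : ContinuousOn (fun s : ℝ => - Real.sqrt (1 - s ^ 2)) (Set.Icc 0 1) := by
    apply Continuous.continuousOn; fun_prop
  have hd : ∀ t ∈ Set.Ioo (0 : ℝ) 1, HasDerivAt (fun s : ℝ => - Real.sqrt (1 - s ^ 2))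
      (t * (Real.sqrt (1 - t ^ 2))⁻¹) t := by
    intro t ht
    have hpos : 0 < 1 - t ^ 2 := by nlinarith [ht.1, ht.2]
    have h1 : HasDerivAt (fun t : ℝ => 1 - t ^ 2) (-(2 * t)) t := by
      simpa using (hasDerivAt_pow 2 t).const_sub 1
    convert! (h1.sqrt hpos.ne').neg using 1
    have hb : 0 < Real.sqrt (1 - t ^ 2) := Real.sqrt_pos.2 hpos
    field_simp
  have hi := intervalIntegral.integrableOn_deriv_of_nonneg hc hd (fun t ht =>
    mul_nonneg ht.1.le (by positivity))
  refine ⟨hi.mono_set Set.Ioo_subset_Ioc_self, ?_⟩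
  have := intervalIntegral.integral_eq_sub_of_hasDerivAt_of_le zero_le_one hc hd
    ((intervalIntegrable_iff_integrableOn_Ioc_of_le zero_le_one).2 hi)
  rw [intervalIntegral.integral_of_le zero_le_one, integral_Ioc_eq_integral_Ioo] at this
  rw [this]
  simp

lemma stein_int2 : IntegrableOn (fun s : ℝ => (Real.sqrt (1 - s ^ 2))⁻¹) (Set.Ioo 0 1) ∧
    ∫ s in Set.Ioo (0 : ℝ) 1, (Real.sqrt (1 - s ^ 2))⁻¹ = Real.pi / 2 := by
  have hc : ContinuousOn Real.arcsin (Set.Icc 0 1) := Real.continuous_arcsin.continuousOn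
  have hd : ∀ t ∈ Set.Ioo (0 : ℝ) 1, HasDerivAt Real.arcsin
      ((Real.sqrt (1 - t ^ 2))⁻¹) t := by
    intro t ht
    have := Real.hasDerivAt_arcsin (x := t) (by linarith [ht.1]) (by linarith [ht.2])
    simpa using this
  have hi := intervalIntegral.integrableOn_deriv_of_nonneg hc hd (fun t ht => by positivity)
  refine ⟨hi.mono_set Set.Ioo_subset_Ioc_self, ?_⟩
  have := intervalIntegral.integral_eq_sub_of_hasDerivAt_of_le zero_le_one hc hd
    ((intervalIntegrable_iff_integrableOn_Ioc_of_le zero_le_one).2 hi)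
  rw [intervalIntegral.integral_of_le zero_le_one, integral_Ioc_eq_integral_Ioo] at this
  rw [this]
  simp

lemma stein_bound1 (G G' : ℝ → ℝ) (K : ℝ)
    (hG : ∀ x, HasDerivAt G (G' x) x) (hGc : Continuous G') (hGb : ∀ x, |G x| ≤ K)
    (hGb' : ∀ x, |G' x| ≤ K) (h1 : ∀ x, |G x| ≤ 1) (x : ℝ) :
    |∫ ω, ω.1 * G' (ω.1 * x + Real.sqrt (1 - ω.1 ^ 2) * ω.2) ∂steinMu|
      ≤ Real.sqrt (2 / Real.pi) := by
  have i2 : Integrable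
      (fun ω : ℝ × ℝ => ω.1 * G' (ω.1 * x + Real.sqrt (1 - ω.1 ^ 2) * ω.2)) steinMu :=
    stein_integrable_bdd _ K (by fun_prop) (fun ω hω => by
      rw [norm_mul, Real.norm_eq_abs, abs_of_pos hω.1, Real.norm_eq_abs]
      have := hGb' (ω.1 * x + Real.sqrt (1 - ω.1 ^ 2) * ω.2)
      have := abs_nonneg (G' (ω.1 * x + Real.sqrt (1 - ω.1 ^ 2) * ω.2))
      have := hω.2
      nlinarith)
  have e := integral_prod _ i2
  have e2 : Real.sqrt (2 / Real.pi)
      = ∫ s in Set.Ioo (0 : ℝ) 1, Real.sqrt (2 / Real.pi) * (s * (Real.sqrt (1 - s ^ 2))⁻¹) := by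
    rw [integral_const_mul, stein_int1.2, mul_one]
  rw [steinMu, e, e2, ← Real.norm_eq_abs]
  refine norm_integral_le_of_norm_le (stein_int1.1.const_mul _) ?_
  filter_upwards [ae_restrict_mem measurableSet_Ioo] with s hs
  have hb : 0 < Real.sqrt (1 - s ^ 2) := Real.sqrt_pos.2 (by nlinarith [hs.1, hs.2])
  have := stein_smooth_bound G G' K 1 (s * x) (Real.sqrt (1 - s ^ 2)) hb hG hGb hGc hGb' h1
  rw [integral_const_mul, Real.norm_eq_abs, abs_mul, abs_of_pos hs.1]
  have := mul_le_mul_of_nonneg_left this hs.1.le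
  linarith

lemma stein_bound2 (G G' : ℝ → ℝ) (K : ℝ)
    (hG : ∀ x, HasDerivAt G (G' x) x) (hGc : Continuous G') (hGb : ∀ x, |G x| ≤ K)
    (hGb' : ∀ x, |G' x| ≤ K) (h1 : ∀ x, |G x| ≤ 1) (x : ℝ) :
    |∫ ω, G' (ω.1 * x + Real.sqrt (1 - ω.1 ^ 2) * ω.2) ∂steinMu|
      ≤ Real.sqrt (2 * Real.pi) := by
  have i2 : Integrable
      (fun ω : ℝ × ℝ => G' (ω.1 * x + Real.sqrt (1 - ω.1 ^ 2) * ω.2)) steinMu :=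
    stein_integrable_bdd _ K (by fun_prop) (fun ω hω => hGb' _)
  have e := integral_prod _ i2
  have hp := Real.pi_pos
  have e3 : Real.sqrt (2 / Real.pi) * (Real.pi / 2) ≤ Real.sqrt (2 * Real.pi) := by
    apply Real.le_sqrt_of_sq_le
    rw [mul_pow, Real.sq_sqrt (by positivity)]
    field_simp
    nlinarith
  have e2 : ∫ s in Set.Ioo (0 : ℝ) 1, Real.sqrt (2 / Real.pi) * ((Real.sqrt (1 - s ^ 2))⁻¹)
      = Real.sqrt (2 / Real.pi) * (Real.pi / 2) := by
    rw [integral_const_mul, stein_int2.2]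
  refine le_trans ?_ e3
  rw [steinMu, e, ← e2, ← Real.norm_eq_abs]
  refine norm_integral_le_of_norm_le (stein_int2.1.const_mul _) ?_
  filter_upwards [ae_restrict_mem measurableSet_Ioo] with s hs
  have hb : 0 < Real.sqrt (1 - s ^ 2) := Real.sqrt_pos.2 (by nlinarith [hs.1, hs.2])
  have := stein_smooth_bound G G' K 1 (s * x) (Real.sqrt (1 - s ^ 2)) hb hG hGb hGc hGb' h1
  simpa using this

/-! ### Smoothness of the multivariate Stein solution -/

lemma stein_diff_int {V F : Type*} [NormedAddCommGroup V] [NormedSpace ℝ V]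
    [NormedAddCommGroup F] [NormedSpace ℝ F]
    (k : ℝ × ℝ → V → F) (k' : ℝ × ℝ → V → (V →L[ℝ] F)) (K : ℝ)
    (hk : ∀ p, Continuous fun ω => k ω p) (hk' : ∀ p, Continuous fun ω => k' ω p)
    (hb : ∀ ω : ℝ × ℝ, ω.1 ∈ Set.Ioo (0 : ℝ) 1 → ∀ p, ‖k ω p‖ ≤ K)
    (hb' : ∀ ω : ℝ × ℝ, ω.1 ∈ Set.Ioo (0 : ℝ) 1 → ∀ p, ‖k' ω p‖ ≤ K)
    (hd : ∀ ω p, HasFDerivAt (k ω) (k' ω p) p) (p : V) :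
    HasFDerivAt (fun p => ∫ ω, k ω p ∂steinMu) (∫ ω, k' ω p ∂steinMu) p := by
  refine hasFDerivAt_integral_of_dominated_of_fderiv_le (μ := steinMu)
    (F := fun p ω => k ω p) (F' := fun p ω => k' ω p)
    (x₀ := p) (s := Set.univ) (bound := fun _ => K) Filter.univ_mem
    (Filter.Eventually.of_forall fun s => (hk s).aestronglyMeasurable) ?_ ?_ ?_ ?_ ?_
  · exact stein_integrable_bdd _ K (hk p) (fun ω hω => hb ω hω p)
  · exact (hk' p).aestronglyMeasurable
  · filter_upwards [steinMu_ae] with ω hω p _ using hb' ω hω p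
  · exact integrable_const _
  · exact Filter.Eventually.of_forall fun ω p _ => hd ω p

section multi
set_option linter.unusedSectionVars false
variable {E : Type*} [NormedAddCommGroup E] [NormedSpace ℝ E]

/-- linear part of the interpolation map -/
noncomputable def steinA (E : Type*) [NormedAddCommGroup E] [NormedSpace ℝ E] (ω : ℝ × ℝ) :
    (ℝ × E) →L[ℝ] (ℝ × E) :=
  ω.1 • (ContinuousLinearMap.inl ℝ ℝ E).comp (ContinuousLinearMap.fst ℝ ℝ E)
    + (ContinuousLinearMap.inr ℝ ℝ E).comp (ContinuousLinearMap.snd ℝ ℝ E)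

/-- interpolation map -/
noncomputable def steinT (ω : ℝ × ℝ) (p : ℝ × E) : ℝ × E :=
  (ω.1 * p.1 + Real.sqrt (1 - ω.1 ^ 2) * ω.2, p.2)

lemma steinA_apply (ω : ℝ × ℝ) (p : ℝ × E) : steinA E ω p = (ω.1 * p.1, p.2) := by
  simp [steinA]

lemma steinT_eq (ω : ℝ × ℝ) (p : ℝ × E) :
    steinT ω p = steinA E ω p + (Real.sqrt (1 - ω.1 ^ 2) * ω.2, 0) := by
  simp [steinA_apply, steinT]

lemma steinA_cont : Continuous (steinA E) := by
  unfold steinA; fun_prop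

lemma steinT_cont (p : ℝ × E) : Continuous fun ω => steinT ω p := by
  unfold steinT; fun_prop

lemma steinA_norm (ω : ℝ × ℝ) (hω : ω.1 ∈ Set.Ioo (0 : ℝ) 1) : ‖steinA E ω‖ ≤ 1 := by
  refine ContinuousLinearMap.opNorm_le_bound _ zero_le_one fun p => ?_
  rw [steinA_apply, one_mul, Prod.norm_def, Prod.norm_def]
  refine max_le_max ?_ le_rfl
  simp only [norm_mul]
  refine mul_le_of_le_one_left (norm_nonneg _) ?_
  rw [Real.norm_eq_abs, abs_of_pos hω.1]
  exact hω.2.le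

lemma steinT_deriv (ω : ℝ × ℝ) (p : ℝ × E) : HasFDerivAt (steinT ω) (steinA E ω) p := by
  have : steinT ω = fun p : ℝ × E => steinA E ω p + (Real.sqrt (1 - ω.1 ^ 2) * ω.2, (0 : E)) :=
    funext (steinT_eq ω)
  rw [this]
  exact (steinA E ω).hasFDerivAt.add_const _

set_option maxSynthPendingDepth 5 in
lemma stein_c2 {F : Type*} [NormedAddCommGroup F] [NormedSpace ℝ F] (g : ℝ × E → F) (K : ℝ)
    (hg : ContDiff ℝ 2 g) (h0 : ∀ p, ‖g p‖ ≤ K) (h1 : ∀ p, ‖fderiv ℝ g p‖ ≤ K)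
    (h2 : ∀ p, ‖fderiv ℝ (fderiv ℝ g) p‖ ≤ K) :
    (∀ p, HasFDerivAt (fun p => ∫ ω, g (steinT ω p) ∂steinMu)
      (∫ ω, (fderiv ℝ g (steinT ω p)).comp (steinA E ω) ∂steinMu) p) ∧
    Differentiable ℝ
      (fun p => ∫ ω, (fderiv ℝ g (steinT ω p)).comp (steinA E ω) ∂steinMu) := by
  have hK : 0 ≤ K := (norm_nonneg _).trans (h0 0)
  have hg1 : ContDiff ℝ 1 (fderiv ℝ g) := hg.fderiv_right (by norm_num)
  have hg2 : Continuous (fderiv ℝ (fderiv ℝ g)) := hg1.continuous_fderiv (by norm_num)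
  have hb1 : ∀ ω : ℝ × ℝ, ω.1 ∈ Set.Ioo (0 : ℝ) 1 → ∀ p,
      ‖(fderiv ℝ g (steinT ω p)).comp (steinA E ω)‖ ≤ K := by
    intro ω hω p
    refine (ContinuousLinearMap.opNorm_comp_le _ _).trans ?_
    have := mul_le_mul (h1 (steinT ω p)) (steinA_norm (E := E) ω hω) (norm_nonneg _) hK
    simpa using this
  have hc1 : ∀ p, Continuous fun ω => (fderiv ℝ g (steinT ω p)).comp (steinA E ω) := fun p =>
    (hg1.continuous.comp (steinT_cont p)).clm_comp steinA_cont
  refine ⟨stein_diff_int _ _ K (fun p => hg.continuous.comp (steinT_cont p)) hc1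
    (fun ω _ p => h0 _) hb1 ?_, ?_⟩
  · intro ω p
    exact ((hg.differentiable (by norm_num) _).hasFDerivAt).comp p (steinT_deriv ω p)
  · intro p
    refine (stein_diff_int (fun ω p => (fderiv ℝ g (steinT ω p)).comp (steinA E ω))
      (fun ω p => ((ContinuousLinearMap.compL ℝ (ℝ × E) (ℝ × E) F).flip (steinA E ω)).comp
        ((fderiv ℝ (fderiv ℝ g) (steinT ω p)).comp (steinA E ω))) K hc1 ?_ hb1 ?_ ?_
        p).differentiableAt
    · intro p
      exact (((ContinuousLinearMap.compL ℝ (ℝ × E) (ℝ × E) F).flip.continuous).comp steinA_cont).clm_comp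
        ((hg2.comp (steinT_cont p)).clm_comp steinA_cont)
    · intro ω hω p
      have hA := steinA_norm (E := E) ω hω
      have hn : ‖(ContinuousLinearMap.compL ℝ (ℝ × E) (ℝ × E) F).flip (steinA E ω)‖ ≤ 1 := by
        refine ContinuousLinearMap.opNorm_le_bound _ zero_le_one fun B => ?_
        rw [ContinuousLinearMap.flip_apply, ContinuousLinearMap.compL_apply, one_mul]
        refine (ContinuousLinearMap.opNorm_comp_le _ _).trans ?_
        exact mul_le_of_le_one_right (norm_nonneg _) hA
      refine (ContinuousLinearMap.opNorm_comp_le _ _).trans ?_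
      refine (mul_le_of_le_one_left (norm_nonneg _) hn).trans ?_
      refine (ContinuousLinearMap.opNorm_comp_le _ _).trans ?_
      exact (mul_le_of_le_one_right (norm_nonneg _) hA).trans (h2 _)
    · intro ω p
      have h3 := ((hg1.differentiable (by norm_num) _).hasFDerivAt).comp p (steinT_deriv ω p)
      exact ((ContinuousLinearMap.compL ℝ (ℝ × E) (ℝ × E) F).flip
        (steinA E ω)).hasFDerivAt.comp p h3

set_option maxSynthPendingDepth 5 in
set_option maxHeartbeats 1000000 in
/-- Everything about the Stein solution for a smooth `h`. -/
lemma stein_smooth (h : ℝ × E → ℝ) (K : ℝ) (hh : ContDiff ℝ 3 h)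
    (hx : ∀ p, |fderiv ℝ h p (1, 0)| ≤ 1)
    (h1 : ∀ p, ‖fderiv ℝ h p‖ ≤ K)
    (h2 : ∀ p, ‖fderiv ℝ (fderiv ℝ h) p‖ ≤ K)
    (h3 : ∀ p, ‖fderiv ℝ (fderiv ℝ (fderiv ℝ h)) p‖ ≤ K) :
    ∃ f : ℝ × E → ℝ, Differentiable ℝ f ∧ Differentiable ℝ (fderiv ℝ f) ∧
      (∀ p, |f p| ≤ 2) ∧
      (∀ p, |fderiv ℝ f p (1, 0)| ≤ Real.sqrt (2 / Real.pi)) ∧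
      (∀ p, |fderiv ℝ (fun q => fderiv ℝ f q (1, 0)) p (1, 0)| ≤ 2) ∧
      (∀ v : E, (∀ p, |fderiv ℝ h p (0, v)| ≤ 1) →
        (∀ p, |fderiv ℝ f p (0, v)| ≤ Real.sqrt (2 * Real.pi)) ∧
        (∀ p, |fderiv ℝ (fun q => fderiv ℝ f q (0, v)) p (1, 0)| ≤ 4)) ∧
      (∀ x y, fderiv ℝ f (x, y) (1, 0) - x * f (x, y)
        = h (x, y) - ∫ z, h (z, y) ∂(gaussianReal 0 1)) := by
  have hK : 0 ≤ K := (norm_nonneg _).trans (h1 0)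
  have hd1 : ContDiff ℝ 2 (fderiv ℝ h) := hh.fderiv_right (by norm_num)
  have hd2 : ContDiff ℝ 1 (fderiv ℝ (fderiv ℝ h)) := hd1.fderiv_right (by norm_num)
  have hd3 : Continuous (fderiv ℝ (fderiv ℝ (fderiv ℝ h))) := hd2.continuous_fderiv (by norm_num)
  -- directional derivatives
  set ev : ℝ × E → (((ℝ × E) →L[ℝ] ℝ) →L[ℝ] ℝ) := fun v => ContinuousLinearMap.apply ℝ ℝ v with hev
  have evn : ∀ v, ‖ev v‖ ≤ ‖v‖ := fun v => by
    refine ContinuousLinearMap.opNorm_le_bound _ (norm_nonneg _) fun B => ?_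
    rw [mul_comm]
    exact B.le_opNorm v
  have D : ∀ v, ContDiff ℝ 2 (fun p => fderiv ℝ h p v) := fun v => hd1.clm_apply contDiff_const
  have D1 : ∀ v p, fderiv ℝ (fun p => fderiv ℝ h p v) p = (ev v).comp (fderiv ℝ (fderiv ℝ h) p) :=
    fun v p => ((ev v).hasFDerivAt.comp p
      ((hd1.differentiable (by norm_num) p).hasFDerivAt)).fderiv
  have D2 : ∀ v p, fderiv ℝ (fderiv ℝ (fun p => fderiv ℝ h p v)) p
      = (ContinuousLinearMap.compL ℝ (ℝ × E) ((ℝ × E) →L[ℝ] ℝ) ℝ (ev v)).comp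
        (fderiv ℝ (fderiv ℝ (fderiv ℝ h)) p) := fun v p => by
    rw [show fderiv ℝ (fun p => fderiv ℝ h p v)
      = fun p => (ContinuousLinearMap.compL ℝ (ℝ × E) ((ℝ × E) →L[ℝ] ℝ) ℝ (ev v))
          (fderiv ℝ (fderiv ℝ h) p) from funext (D1 v)]
    exact ((ContinuousLinearMap.compL ℝ (ℝ × E) ((ℝ × E) →L[ℝ] ℝ) ℝ (ev v)).hasFDerivAt.comp p
      ((hd2.differentiable (by norm_num) p).hasFDerivAt)).fderiv
  have B0 : ∀ v p, ‖fderiv ℝ h p v‖ ≤ K * ‖v‖ := fun v p =>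
    ((fderiv ℝ h p).le_opNorm v).trans (mul_le_mul_of_nonneg_right (h1 p) (norm_nonneg _))
  have B1 : ∀ v p, ‖fderiv ℝ (fun p => fderiv ℝ h p v) p‖ ≤ K * ‖v‖ := fun v p => by
    rw [D1, mul_comm]
    exact (ContinuousLinearMap.opNorm_comp_le _ _).trans
      (mul_le_mul (evn v) (h2 p) (norm_nonneg _) (norm_nonneg _))
  have B2 : ∀ v p, ‖fderiv ℝ (fderiv ℝ (fun p => fderiv ℝ h p v)) p‖ ≤ K * ‖v‖ := fun v p => by
    rw [D2, mul_comm]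
    refine (ContinuousLinearMap.opNorm_comp_le _ _).trans
      (mul_le_mul ?_ (h3 p) (norm_nonneg _) (norm_nonneg _))
    refine le_trans (ContinuousLinearMap.opNorm_le_bound _ (norm_nonneg (ev v)) fun B => ?_) (evn v)
    exact ContinuousLinearMap.opNorm_comp_le _ _
  have hsymm : ∀ p v w, fderiv ℝ (fderiv ℝ h) p v w = fderiv ℝ (fderiv ℝ h) p w v := by
    intro p v w
    have : IsSymmSndFDerivAt ℝ h p := (hh.contDiffAt).isSymmSndFDerivAt (by simp; norm_num)
    exact this v w
  have n10 : ‖((1 : ℝ), (0 : E))‖ = 1 := by simp [Prod.norm_def]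
  -- sections in the first variable
  have sec : ∀ (k : ℝ × E → ℝ), Differentiable ℝ k → ∀ x y,
      HasDerivAt (fun x => k (x, y)) (fderiv ℝ k (x, y) (1, 0)) x := by
    intro k hk x y
    have h4 : HasDerivAt (fun x : ℝ => (x, y)) ((1 : ℝ), (0 : E)) x :=
      (hasDerivAt_id x).prodMk (hasDerivAt_const x y)
    exact (hk (x, y)).hasFDerivAt.comp_hasDerivAt x h4
  set g : ℝ × E → ℝ := fun p => fderiv ℝ h p (1, 0) with hgdef
  have hg2 : ContDiff ℝ 2 g := D (1, 0)
  have gB0 : ∀ p, ‖g p‖ ≤ K := fun p => by simpa [n10] using B0 (1, 0) p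
  have gB1 : ∀ p, ‖fderiv ℝ g p‖ ≤ K := fun p => by simpa [n10] using B1 (1, 0) p
  have gB2 : ∀ p, ‖fderiv ℝ (fderiv ℝ g) p‖ ≤ K := fun p => by simpa [n10] using B2 (1, 0) p
  obtain ⟨c1, c2⟩ := stein_c2 g K hg2 gB0 gB1 gB2
  set f : ℝ × E → ℝ := fun p => - ∫ ω, g (steinT ω p) ∂steinMu with hf
  have hfd : ∀ p, HasFDerivAt f
      (-∫ ω, (fderiv ℝ g (steinT ω p)).comp (steinA E ω) ∂steinMu) p := fun p => (c1 p).neg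
  have hff : fderiv ℝ f = fun p => -∫ ω, (fderiv ℝ g (steinT ω p)).comp (steinA E ω) ∂steinMu :=
    funext fun p => (hfd p).fderiv
  have hfD : Differentiable ℝ f := fun p => (hfd p).differentiableAt
  have hfD2 : Differentiable ℝ (fderiv ℝ f) := by rw [hff]; exact c2.neg
  have hI : ∀ p, Integrable (fun ω => (fderiv ℝ g (steinT ω p)).comp (steinA E ω)) steinMu := by
    intro p
    refine stein_integrable_bdd _ K (((hg2.continuous_fderiv (by norm_num)).comp
      (steinT_cont p)).clm_comp steinA_cont) fun ω hω => ?_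
    refine (ContinuousLinearMap.opNorm_comp_le _ _).trans ?_
    have := mul_le_mul (gB1 (steinT ω p)) (steinA_norm (E := E) ω hω) (norm_nonneg _) hK
    simpa using this
  have hfv : ∀ p v, fderiv ℝ f p v = -∫ ω, fderiv ℝ g (steinT ω p) (steinA E ω v) ∂steinMu := by
    intro p v
    rw [hff]
    simp only [neg_apply]
    rw [ContinuousLinearMap.integral_apply (hI p)]
    rfl
  have gd : ∀ y x, HasDerivAt (fun x => g (x, y)) (fderiv ℝ g (x, y) (1, 0)) x :=
    fun y x => sec g (hg2.differentiable (by norm_num)) x y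
  have hdx : ∀ y x, HasDerivAt (fun x => h (x, y)) (g (x, y)) x :=
    fun y x => sec h (hh.differentiable (by norm_num)) x y
  have g'c : ∀ y, Continuous fun x : ℝ => fderiv ℝ g (x, y) (1, 0) := fun y =>
    (((hg2.continuous_fderiv (by norm_num)).comp (by fun_prop : Continuous fun x : ℝ => (x, y)))
      ).clm_apply continuous_const
  have g'b : ∀ y x, |fderiv ℝ g (x, y) (1, 0)| ≤ K := fun y x => by
    have := (fderiv ℝ g (x, y)).le_opNorm (1, 0)
    rw [n10, mul_one] at this
    exact this.trans (gB1 _)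
  have fx : ∀ x y, fderiv ℝ f (x, y) (1, 0) = - ∫ ω, ω.1 *
      fderiv ℝ g (ω.1 * x + Real.sqrt (1 - ω.1 ^ 2) * ω.2, y) (1, 0) ∂steinMu := by
    intro x y
    rw [hfv]
    congr 2
    funext ω
    rw [steinA_apply]
    have : ((ω.1 * ((1 : ℝ), (0 : E)).1, ((1 : ℝ), (0 : E)).2) : ℝ × E)
      = ω.1 • ((1 : ℝ), (0 : E)) := by simp
    rw [this, map_smul]
    rfl
  have stein : ∀ x y, fderiv ℝ f (x, y) (1, 0) = x * f (x, y)
        + (h (x, y) - ∫ z, h (z, y) ∂(gaussianReal 0 1)) := by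
    intro x y
    have := stein_identity (fun x => h (x, y)) (fun x => g (x, y))
      (fun x => fderiv ℝ g (x, y) (1, 0)) K (hdx y) (gd y) (g'c y) (fun x => gB0 _) (g'b y) x
    rw [fx, ← this, hf]
    simp only [steinT]
    ring
  have fb : ∀ p, |f p| ≤ 1 := by
    intro p
    rw [hf]
    simp only [abs_neg]
    have := norm_integral_le_of_norm_le_const (μ := steinMu) (f := fun ω => g (steinT ω p))
      (C := 1) (Filter.Eventually.of_forall fun ω => hx _)
    simpa using this
  refine ⟨f, hfD, hfD2, fun p => (fb p).trans (by norm_num), ?_, ?_, ?_, ?_⟩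
  · rintro ⟨x, y⟩
    rw [fx, abs_neg]
    exact stein_bound1 (fun x => g (x, y)) (fun x => fderiv ℝ g (x, y) (1, 0)) K (gd y) (g'c y)
      (fun x => gB0 _) (g'b y) (fun x => hx _) x
  · rintro ⟨x, y⟩
    have s1 := sec (fun q => fderiv ℝ f q (1, 0))
      (hfD2.clm_apply (differentiable_const _)) x y
    have hF : ∀ x, HasDerivAt (fun x => f (x, y)) (x * f (x, y)
        + (h (x, y) - ∫ z, h (z, y) ∂(gaussianReal 0 1))) x := fun x => by
      rw [← stein]; exact sec f hfD x y
    have hH : ∀ x, HasDerivAt (fun x => h (x, y) - ∫ z, h (z, y) ∂(gaussianReal 0 1))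
      (g (x, y)) x := fun x => (hdx y x).sub_const _
    have s2 : HasDerivAt (fun x => fderiv ℝ f (x, y) (1, 0))
        (f (x, y) + x * (x * f (x, y) + (h (x, y) - ∫ z, h (z, y) ∂(gaussianReal 0 1)))
          + g (x, y)) x := by
      simp only [stein]
      convert! ((hasDerivAt_id x).mul (hF x)).add (hH x) using 1
      simp
    rw [s1.unique s2]
    exact stein_second (fun x => f (x, y)) _ _ 1 hF (fun x => fb _) hH (fun x => hx _) x
  · intro v hv
    set k : ℝ × E → ℝ := fun p => fderiv ℝ h p (0, v) with hk
    set K' := K * (1 + ‖v‖) with hK'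
    have hKK : K * ‖((0 : ℝ), v)‖ ≤ K' := by
      simp only [Prod.norm_def, norm_zero]
      rw [max_eq_right (norm_nonneg _)]
      nlinarith
    have k2 : ContDiff ℝ 2 k := D (0, v)
    have kx : ∀ p, fderiv ℝ k p (1, 0) = fderiv ℝ g p (0, v) := fun p => by
      rw [D1, D1]
      exact hsymm p _ _
    set k1 : ℝ × E → ℝ := fun p => fderiv ℝ k p (1, 0) with hk1
    have k1c : ContDiff ℝ 1 k1 := (k2.fderiv_right (by norm_num)).clm_apply contDiff_const
    have k1d : ∀ p, fderiv ℝ k1 p (1, 0) = fderiv ℝ (fderiv ℝ k) p (1, 0) (1, 0) := fun p => by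
      have : HasFDerivAt k1 ((ev (1, 0)).comp (fderiv ℝ (fderiv ℝ k) p)) p :=
        (ev (1, 0)).hasFDerivAt.comp p (((k2.fderiv_right (m := 1)
          (by norm_num)).differentiable (by norm_num) p).hasFDerivAt)
      rw [this.fderiv]
      rfl
    have kd : ∀ y x, HasDerivAt (fun x => k (x, y)) (k1 (x, y)) x :=
      fun y x => sec k (k2.differentiable (by norm_num)) x y
    have k1dd : ∀ y x, HasDerivAt (fun x => k1 (x, y)) (fderiv ℝ k1 (x, y) (1, 0)) x :=
      fun y x => sec k1 (k1c.differentiable (by norm_num)) x y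
    have k1b : ∀ p, |k1 p| ≤ K' := fun p => by
      have := (fderiv ℝ k p).le_opNorm (1, 0)
      rw [n10, mul_one] at this
      exact this.trans ((B1 (0, v) p).trans hKK)
    have k1b' : ∀ p, |fderiv ℝ k1 p (1, 0)| ≤ K' := fun p => by
      rw [k1d]
      have a1 := (fderiv ℝ (fderiv ℝ k) p (1, 0)).le_opNorm (1, 0)
      have a2 := (fderiv ℝ (fderiv ℝ k) p).le_opNorm (1, 0)
      rw [n10, mul_one] at a1 a2
      exact a1.trans (a2.trans ((B2 (0, v) p).trans hKK))
    have kb : ∀ p, |k p| ≤ K' := fun p => (B0 (0, v) p).trans hKK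
    have k1cy : ∀ y, Continuous fun x : ℝ => k1 (x, y) := fun y =>
      k1c.continuous.comp (by fun_prop)
    have k1cy' : ∀ y, Continuous fun x : ℝ => fderiv ℝ k1 (x, y) (1, 0) := fun y =>
      (((k1c.continuous_fderiv (by norm_num)).comp
        (by fun_prop : Continuous fun x : ℝ => (x, y)))).clm_apply continuous_const
    have fv : ∀ x y, fderiv ℝ f (x, y) (0, v) = - ∫ ω,
        k1 (ω.1 * x + Real.sqrt (1 - ω.1 ^ 2) * ω.2, y) ∂steinMu := by
      intro x y
      rw [hfv]
      congr 2
      funext ω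
      rw [steinA_apply, hk1]
      simp only [mul_zero]
      rw [kx]
      rfl
    have fvb : ∀ p, |fderiv ℝ f p (0, v)| ≤ Real.sqrt (2 * Real.pi) := by
      rintro ⟨x, y⟩
      rw [fv, abs_neg]
      exact stein_bound2 (fun x => k (x, y)) (fun x => k1 (x, y)) K' (kd y) (k1cy y)
        (fun x => kb _) (fun x => k1b _) (fun x => hv _) x
    refine ⟨fvb, ?_⟩
    rintro ⟨x, y⟩
    have s1 := sec (fun q => fderiv ℝ f q (0, v))
      (hfD2.clm_apply (differentiable_const _)) x y
    have s2 : ∀ x, HasDerivAt (fun x => fderiv ℝ f (x, y) (0, v))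
        (x * fderiv ℝ f (x, y) (0, v) + (k (x, y) - ∫ z, k (z, y) ∂(gaussianReal 0 1))) x := by
      intro x
      have a1 := (stein_hasDeriv (fun x => k1 (x, y)) (fun x => fderiv ℝ k1 (x, y) (1, 0)) K'
        (k1dd y) (k1cy' y) (fun x => k1b _) (fun x => k1b' _) x).neg
      have a2 := stein_identity (fun x => k (x, y)) (fun x => k1 (x, y))
        (fun x => fderiv ℝ k1 (x, y) (1, 0)) K' (kd y) (k1dd y) (k1cy' y) (fun x => k1b _)
        (fun x => k1b' _) x
      simp only [fv]
      convert! a1 using 1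
      rw [← a2]
      ring
    have hr : ∀ x, |k (x, y) - ∫ z, k (z, y) ∂(gaussianReal 0 1)| ≤ 2 := fun x => by
      refine (abs_sub _ _).trans ?_
      have := norm_integral_le_of_norm_le_const (μ := gaussianReal 0 1) (f := fun z => k (z, y))
        (C := 1) (Filter.Eventually.of_forall fun ω => hv _)
      have h5 := hv (x, y)
      simp only [Real.norm_eq_abs, probReal_univ, mul_one] at this
      linarith
    have hm := stein_mills (fun x => fderiv ℝ f (x, y) (0, v)) _ 2 _ s2 (fun x => fvb _) hr x
    rw [s1.unique (s2 x)]
    refine (abs_add_le _ _).trans ?_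
    have := hr x
    linarith
  · intro x y
    rw [stein]
    ring

end multi

/-! ### Mollification -/

section moll
set_option linter.unusedSectionVars false
variable {W : Type*} [NormedAddCommGroup W] [NormedSpace ℝ W] [FiniteDimensional ℝ W]
  [MeasurableSpace W] [BorelSpace W]

lemma stein_conv_lip (μ : Measure W) [μ.IsAddHaarMeasure]
    {F F' : Type*} [NormedAddCommGroup F] [NormedSpace ℝ F]
    [NormedAddCommGroup F'] [NormedSpace ℝ F']
    (L : F →L[ℝ] ℝ →L[ℝ] F') (k : W → F) (hk : Continuous k) (hks : HasCompactSupport k)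
    (h : W → ℝ) (hc : Continuous h) (M : ℝ) (hM : ∀ p q, |h p - h q| ≤ M * ‖p - q‖) :
    ∃ K, ∀ p q, ‖convolution k h L μ p - convolution k h L μ q‖ ≤ K * ‖p - q‖ := by
  have hex := fun p => HasCompactSupport.convolutionExists_left (μ := μ) L hks hk
    hc.locallyIntegrable p
  have hki : Integrable k μ := hk.integrable_of_hasCompactSupport hks
  refine ⟨∫ t, ‖L‖ * M * ‖k t‖ ∂μ, fun p q => ?_⟩
  unfold convolution
  rw [← integral_sub (hex p) (hex q), ← integral_mul_const]
  refine norm_integral_le_of_norm_le ((hki.norm.const_mul _).mul_const _)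
    (Filter.Eventually.of_forall fun t => ?_)
  rw [← map_sub]
  refine (L.le_opNorm₂ _ _).trans ?_
  have h1 := hM (p - t) (q - t)
  rw [sub_sub_sub_cancel_right] at h1
  have h2 := mul_le_mul_of_nonneg_left h1 (mul_nonneg (norm_nonneg L) (norm_nonneg (k t)))
  rw [Real.norm_eq_abs]
  linarith

lemma stein_fderiv_bdd {F' : Type*} [NormedAddCommGroup F'] [NormedSpace ℝ F'] (u : W → F') (K : ℝ)
    (hu : ∀ p q, ‖u p - u q‖ ≤ K * ‖p - q‖) (p : W) : ‖fderiv ℝ u p‖ ≤ |K| := by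
  refine norm_fderiv_le_of_lip' ℝ (abs_nonneg K) (Filter.Eventually.of_forall fun q => ?_)
  exact (hu q p).trans (mul_le_mul_of_nonneg_right (le_abs_self K) (norm_nonneg _))

set_option maxSynthPendingDepth 5 in
lemma stein_moll (μ : Measure W) [μ.IsAddHaarMeasure]
    (h : W → ℝ) (M : ℝ) (hM : ∀ p q, |h p - h q| ≤ M * ‖p - q‖)
    (N : W → ℝ) (hN : ∀ p q, |h p - h q| ≤ N (p - q)) (ε : ℝ) (hε : 0 < ε) :
    ∃ u : W → ℝ, ContDiff ℝ 3 u ∧ (∀ p q, |u p - u q| ≤ N (p - q)) ∧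
      (∀ p, |u p - h p| ≤ |M| * ε) ∧ ∃ K, (∀ p, ‖fderiv ℝ u p‖ ≤ K) ∧
      (∀ p, ‖fderiv ℝ (fderiv ℝ u) p‖ ≤ K) ∧
      (∀ p, ‖fderiv ℝ (fderiv ℝ (fderiv ℝ u)) p‖ ≤ K) := by
  have hc : Continuous h := by
    have : LipschitzWith (Real.toNNReal |M|) h := LipschitzWith.of_dist_le_mul fun p q => by
      rw [dist_eq_norm, dist_eq_norm, Real.coe_toNNReal _ (abs_nonneg _)]
      exact (hM p q).trans (mul_le_mul_of_nonneg_right (le_abs_self M) (norm_nonneg _))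
    exact this.continuous
  have hl : LocallyIntegrable h μ := hc.locallyIntegrable
  let b : ContDiffBump (0 : W) := ⟨ε / 2, ε, by positivity, by linarith⟩
  set φ : W → ℝ := b.normed μ with hφ
  have φs : HasCompactSupport φ := b.hasCompactSupport_normed
  have φc : ContDiff ℝ 3 φ := b.contDiff_normed
  set L := ContinuousLinearMap.lsmul ℝ ℝ (E := ℝ) with hL
  have φ1 : ContDiff ℝ 2 (fderiv ℝ φ) := φc.fderiv_right (by norm_num)
  have φ2 : ContDiff ℝ 1 (fderiv ℝ (fderiv ℝ φ)) := φ1.fderiv_right (by norm_num)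
  have s1 : HasCompactSupport (fderiv ℝ φ) := φs.fderiv ℝ
  have s2 : HasCompactSupport (fderiv ℝ (fderiv ℝ φ)) := s1.fderiv ℝ
  have e1 : fderiv ℝ (convolution φ h L μ) = convolution (fderiv ℝ φ) h (L.precompL W) μ :=
    funext fun p => (φs.hasFDerivAt_convolution_left L (φc.of_le (by norm_num)) hl p).fderiv
  have e2 : fderiv ℝ (convolution (fderiv ℝ φ) h (L.precompL W) μ)
      = convolution (fderiv ℝ (fderiv ℝ φ)) h ((L.precompL W).precompL W) μ :=
    funext fun p => (s1.hasFDerivAt_convolution_left _ (φ1.of_le (by norm_num)) hl p).fderiv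
  obtain ⟨K0, hK0⟩ := stein_conv_lip μ L φ φc.continuous φs h hc M hM
  obtain ⟨K1, hK1⟩ := stein_conv_lip μ (L.precompL W) _ φ1.continuous s1 h hc M hM
  obtain ⟨K2, hK2⟩ := stein_conv_lip μ ((L.precompL W).precompL W) _ φ2.continuous s2 h hc M hM
  refine ⟨convolution φ h L μ, ?_, ?_, ?_, |K0| + |K1| + |K2|, ?_, ?_, ?_⟩
  · exact φs.contDiff_convolution_left (n := 3) L φc hl
  · intro p q
    have hex := fun p => HasCompactSupport.convolutionExists_left (μ := μ) L φs φc.continuous hl p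
    have hi : ∫ t, φ t * N (p - q) ∂μ = N (p - q) := by
      rw [integral_mul_const, b.integral_normed, one_mul]
    unfold convolution
    rw [← integral_sub (hex p) (hex q)]
    rw [← hi, ← Real.norm_eq_abs]
    refine norm_integral_le_of_norm_le
      ((φc.continuous.integrable_of_hasCompactSupport φs).mul_const _)
      (Filter.Eventually.of_forall fun t => ?_)
    rw [← map_sub]
    simp only [hL, ContinuousLinearMap.lsmul_apply, smul_eq_mul, Real.norm_eq_abs, abs_mul]
    rw [abs_of_nonneg (b.nonneg_normed t)]
    have h1 := hN (p - t) (q - t)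
    rw [sub_sub_sub_cancel_right] at h1
    exact mul_le_mul_of_nonneg_left h1 (b.nonneg_normed t)
  · intro p
    refine ContDiffBump.dist_normed_convolution_le hc.aestronglyMeasurable fun q hq => ?_
    rw [Real.dist_eq]
    refine (hM q p).trans ?_
    rw [Metric.mem_ball, dist_eq_norm] at hq
    have : ‖q - p‖ ≤ ε := hq.le
    exact (mul_le_mul_of_nonneg_right (le_abs_self M) (norm_nonneg _)).trans
      (mul_le_mul_of_nonneg_left this (abs_nonneg _))
  · intro p
    have := stein_fderiv_bdd _ _ hK0 p
    have := abs_nonneg K1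
    have := abs_nonneg K2
    linarith
  · intro p
    rw [e1]
    have := stein_fderiv_bdd _ _ hK1 p
    have := abs_nonneg K0
    have := abs_nonneg K2
    linarith
  · intro p
    rw [e1, e2]
    have := stein_fderiv_bdd _ _ hK2 p
    have := abs_nonneg K0
    have := abs_nonneg K1
    linarith

end moll

lemma stein_dir_bound {W : Type*} [NormedAddCommGroup W] [NormedSpace ℝ W] (u : W → ℝ)
    (hu : Differentiable ℝ u) (N : W → ℝ) (hN : ∀ p q, |u p - u q| ≤ N (p - q)) (v : W)
    (hv : ∀ t : ℝ, N (t • v) = |t|) (p : W) : |fderiv ℝ u p v| ≤ 1 := by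
  have h1 : HasDerivAt (fun t : ℝ => p + t • v) v 0 := by
    simpa using ((hasDerivAt_id (0 : ℝ)).smul_const v).const_add p
  have h2 : HasDerivAt (fun t : ℝ => u (p + t • v)) (fderiv ℝ u p v) 0 := by
    have h3 : HasFDerivAt u (fderiv ℝ u p) (p + (0 : ℝ) • v) := by
      simpa using (hu p).hasFDerivAt
    exact h3.comp_hasDerivAt 0 h1
  rw [← h2.deriv, ← Real.norm_eq_abs]
  refine norm_deriv_le_of_lip' zero_le_one (Filter.Eventually.of_forall fun t => ?_)
  have := hN (p + t • v) (p + (0 : ℝ) • v)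
  rw [add_sub_add_left_eq_sub, ← sub_smul, hv] at this
  simpa using this

/-- an integrability helper for functions of linear growth -/
lemma stein_growth {Ω : Type*} [MeasurableSpace Ω] (P : Measure Ω) [IsFiniteMeasure P] {E : Type*}
    [NormedAddCommGroup E] [NormedSpace ℝ E] [FiniteDimensional ℝ E] [MeasurableSpace E]
    [BorelSpace E]
    (A : Ω → ℝ) (B : Ω → E) (hA : Integrable A P) (hB : Integrable B P)
    (h : ℝ × E → ℝ) (hc : Continuous h) (hg : ∀ p, |h p| ≤ |h 0| + |p.1| + ‖p.2‖) :
    Integrable (fun ω => h (A ω, B ω)) P := by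
  have hi : Integrable (fun ω => |h 0| + |A ω| + ‖B ω‖) P :=
    ((integrable_const _).add hA.abs).add hB.norm
  refine hi.mono' ?_ (Filter.Eventually.of_forall fun ω => hg _)
  exact hc.comp_aestronglyMeasurable
    (hA.aestronglyMeasurable.prodMk hB.aestronglyMeasurable)

lemma stein_growth_of_lip {E : Type*} [NormedAddCommGroup E] (h : ℝ × E → ℝ)
    (hl : ∀ p q, |h p - h q| ≤ Real.sqrt ((p - q).1 ^ 2 + ‖(p - q).2‖ ^ 2)) :
    Continuous h ∧ (∀ p q, |h p - h q| ≤ 2 * ‖p - q‖) ∧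
      (∀ p, |h p| ≤ |h 0| + |p.1| + ‖p.2‖) := by
  have h1 : ∀ p q, |h p - h q| ≤ |(p - q).1| + ‖(p - q).2‖ := fun p q => by
    refine (hl p q).trans (Real.sqrt_le_iff.2 ⟨by positivity, ?_⟩)
    rw [← sq_abs (p - q).1]
    have := mul_nonneg (abs_nonneg (p - q).1) (norm_nonneg (p - q).2)
    nlinarith
  have h2 : ∀ p q, |h p - h q| ≤ 2 * ‖p - q‖ := fun p q => by
    have a := norm_fst_le (p - q)
    have b := norm_snd_le (p - q)
    rw [Real.norm_eq_abs] at a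
    have := h1 p q
    linarith
  refine ⟨?_, h2, fun p => ?_⟩
  · have : LipschitzWith 2 h := LipschitzWith.of_dist_le_mul fun p q => by
      rw [dist_eq_norm, dist_eq_norm]
      exact h2 p q
    exact this.continuous
  · have := h1 p 0
    rw [sub_zero] at this
    have := abs_sub_abs_le_abs_sub (h p) (h 0)
    linarith

/-- multivariate Stein bound. If the Stein-type functional
`|E[∂ₓ f(X,Y)] − E[X f(X,Y)]|` is bounded by `C` over the class of twice differentiable
test functions `f : ℝ × ℝ^d → ℝ` with `‖f‖_∞ ≤ 2`, `‖∂ₓ f‖_∞ ≤ √(2/π)`,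
`‖∂²ₓₓ f‖_∞ ≤ 2`, `‖∂_{y_j} f‖_∞ ≤ √(2π)`, `‖∂ₓ∂_{y_j} f‖_∞ ≤ 4`, then for every
1-Lipschitz `h`, `|E[h(X,Y)] − ∫ E[h(z,Y)] γ(dz)| ≤ C`, i.e.
`d_Wass((X,Y),(Z',Y)) ≤ C` with `Z' ~ N(0,1)` independent of `Y`. -/
theorem stmt4 {Ω : Type*} [MeasurableSpace Ω] (P : Measure Ω) [IsProbabilityMeasure P]
    (d : ℕ) (hd : 1 ≤ d)
    (X : Ω → ℝ) (Y : Ω → EuclideanSpace ℝ (Fin d))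
    (hXm : Measurable X) (hYm : Measurable Y)
    (hXi : Integrable X P) (hYi : Integrable Y P)
    (C : ℝ) (hC : 0 ≤ C)
    (hstein : ∀ f : ℝ × EuclideanSpace ℝ (Fin d) → ℝ,
      Differentiable ℝ f → Differentiable ℝ (fderiv ℝ f) →
      (∀ p, |f p| ≤ 2) →
      (∀ p, |fderiv ℝ f p (1, 0)| ≤ Real.sqrt (2 / Real.pi)) →
      (∀ p, |fderiv ℝ (fun q => fderiv ℝ f q (1, 0)) p (1, 0)| ≤ 2) →
      (∀ (j : Fin d) p,
        |fderiv ℝ f p (0, EuclideanSpace.single j (1 : ℝ))| ≤ Real.sqrt (2 * Real.pi)) →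
      (∀ (j : Fin d) p,
        |fderiv ℝ (fun q => fderiv ℝ f q (0, EuclideanSpace.single j (1 : ℝ))) p (1, 0)|
          ≤ 4) →
      |(∫ ω, fderiv ℝ f (X ω, Y ω) (1, 0) ∂P) - ∫ ω, X ω * f (X ω, Y ω) ∂P| ≤ C) :
    ∀ h : ℝ × EuclideanSpace ℝ (Fin d) → ℝ,
      (∀ p q, |h p - h q| ≤ Real.sqrt ((p.1 - q.1) ^ 2 + ‖p.2 - q.2‖ ^ 2)) →
      |(∫ ω, h (X ω, Y ω) ∂P) - ∫ z, (∫ ω, h (z, Y ω) ∂P) ∂(gaussianReal 0 1)| ≤ C := by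
  intro h hlip
  set N : ℝ × EuclideanSpace ℝ (Fin d) → ℝ := fun p => Real.sqrt (p.1 ^ 2 + ‖p.2‖ ^ 2) with hN
  have hlN : ∀ p q, |h p - h q| ≤ N (p - q) := hlip
  obtain ⟨hc, h2, hg⟩ := stein_growth_of_lip h hlN
  have hYz : ∀ (u : ℝ × EuclideanSpace ℝ (Fin d) → ℝ), (∀ p q, |u p - u q| ≤ N (p - q)) →
      Integrable (fun ω => u (X ω, Y ω)) P ∧ (∀ z, Integrable (fun ω => u (z, Y ω)) P) ∧
      Integrable (fun q : ℝ × Ω => u (q.1, Y q.2)) ((gaussianReal 0 1).prod P) := by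
    intro u hu
    obtain ⟨uc, -, ug⟩ := stein_growth_of_lip u hu
    refine ⟨stein_growth P X Y hXi hYi u uc ug,
      fun z => stein_growth P (fun _ => z) Y (integrable_const z) hYi u uc ug, ?_⟩
    exact stein_growth ((gaussianReal 0 1).prod P) (fun q : ℝ × Ω => q.1) (fun q => Y q.2)
      (stein_integrable_id.comp_fst P) (hYi.comp_snd (gaussianReal 0 1)) u uc ug
  refine le_of_forall_pos_le_add fun ε hε => ?_
  obtain ⟨u, u3, uN, uh, K, k1, k2, k3⟩ := stein_moll (Measure.addHaar :
    Measure (ℝ × EuclideanSpace ℝ (Fin d))) h 2 h2 N hlN (ε / 4) (by positivity)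
  have hux : ∀ p, |fderiv ℝ u p (1, 0)| ≤ 1 :=
    stein_dir_bound u (u3.differentiable (by norm_num)) N uN (1, 0) (fun t => by
      simp [hN, Real.sqrt_sq_eq_abs])
  have huy : ∀ (j : Fin d) p, |fderiv ℝ u p (0, EuclideanSpace.single j (1 : ℝ))| ≤ 1 := fun j =>
    stein_dir_bound u (u3.differentiable (by norm_num)) N uN _ (fun t => by
      simp [hN, norm_smul, Real.sqrt_sq_eq_abs])
  obtain ⟨f, f1, f2, f3, f4, f5, f6, f7⟩ := stein_smooth u K u3 hux k1 k2 k3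
  have hS := hstein f f1 f2 f3 f4 f5 (fun j => (f6 _ (huy j)).1) (fun j => (f6 _ (huy j)).2)
  obtain ⟨a1, a2, a3⟩ := hYz u uN
  obtain ⟨b1, b2, b3⟩ := hYz h hlN
  have hXY : AEStronglyMeasurable (fun ω => (X ω, Y ω)) P :=
    hXi.aestronglyMeasurable.prodMk hYi.aestronglyMeasurable
  have c1 : Integrable (fun ω => fderiv ℝ f (X ω, Y ω) (1, 0)) P := by
    refine Integrable.of_bound (C := Real.sqrt (2 / Real.pi)) ?_
      (Filter.Eventually.of_forall fun ω => f4 _)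
    exact (f2.continuous.clm_apply continuous_const).comp_aestronglyMeasurable hXY
  have c2 : Integrable (fun ω => X ω * f (X ω, Y ω)) P :=
    hXi.mul_bdd (c := 2) (f1.continuous.comp_aestronglyMeasurable hXY)
      (Filter.Eventually.of_forall fun ω => f3 _)
  rw [← integral_sub c1 c2] at hS
  simp only [f7] at hS
  have c3 : Integrable (fun ω => ∫ z, u (z, Y ω) ∂(gaussianReal 0 1)) P := a3.integral_prod_right
  rw [integral_sub a1 c3, ← integral_integral_swap a3] at hS
  have hε2 : ∀ p, |h p - u p| ≤ ε / 2 := fun p => by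
    rw [abs_sub_comm]
    refine (uh p).trans ?_
    rw [abs_of_pos two_pos]
    linarith
  have d1 : |(∫ ω, h (X ω, Y ω) ∂P) - ∫ ω, u (X ω, Y ω) ∂P| ≤ ε / 2 := by
    rw [← integral_sub b1 a1]
    have := norm_integral_le_of_norm_le_const (μ := P)
      (f := fun ω => h (X ω, Y ω) - u (X ω, Y ω)) (C := ε / 2)
      (Filter.Eventually.of_forall fun ω => hε2 _)
    simpa using this
  have d2 : |(∫ z, (∫ ω, h (z, Y ω) ∂P) ∂(gaussianReal 0 1))
      - ∫ z, (∫ ω, u (z, Y ω) ∂P) ∂(gaussianReal 0 1)| ≤ ε / 2 := by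
    rw [← integral_sub b3.integral_prod_left a3.integral_prod_left]
    have := norm_integral_le_of_norm_le_const (μ := gaussianReal 0 1)
      (f := fun z => (∫ ω, h (z, Y ω) ∂P) - ∫ ω, u (z, Y ω) ∂P) (C := ε / 2)
      (Filter.Eventually.of_forall fun z => by
        rw [← integral_sub (b2 z) (a2 z)]
        have := norm_integral_le_of_norm_le_const (μ := P)
          (f := fun ω => h (z, Y ω) - u (z, Y ω)) (C := ε / 2)
          (Filter.Eventually.of_forall fun ω => hε2 _)
        simpa using this)
    simpa using this
  rw [abs_le] at *
  constructor <;> linarith [d1.1, d1.2, d2.1, d2.2, hS.1, hS.2]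
end

section
/- Let h : ℝ → ℝ be continuously differentiable with ‖h'‖_∞ ≤ 1, and define f_h(x) = e^{x²/2} ∫_{−∞}^{x} (h(t) − ∫_ℝ h dγ) e^{−t²/2} dt. Then f_h is twice differentiable and satisfies f_h'(x) − x·f_h(x) = h(x) − ∫_ℝ h dγ for all x ∈ ℝ, with ‖f_h‖_∞ ≤ 2, ‖f_h'‖_∞ ≤ √(2/π), and ‖f_h''‖_∞ ≤ 2. Moreover, f_h is the unique differentiable function g : ℝ → ℝ satisfying g'(x) − x·g(x) = h(x) − ∫_ℝ h dγ for all x together with the decay condition lim_{|x|→∞} e^{−x²/2} g(x) = 0. -/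
open MeasureTheory ProbabilityTheory

namespace Stein6

open Set Filter Topology

/-- Unnormalised Gaussian weight. -/
noncomputable def W (t : ℝ) : ℝ := Real.exp (-t ^ 2 / 2)

/-- Unnormalised Gaussian distribution function. -/
noncomputable def P (x : ℝ) : ℝ := ∫ t in Iio x, W t

/-- Total mass. -/
noncomputable def T : ℝ := Real.sqrt (2 * Real.pi)

lemma W_pos (x : ℝ) : 0 < W x := Real.exp_pos _

lemma W_neg (x : ℝ) : W (-x) = W x := by simp [W]

lemma W_zero : W 0 = 1 := by simp [W]

lemma T_pos : 0 < T := Real.sqrt_pos.2 (by positivity)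

lemma hasDerivAt_W (x : ℝ) : HasDerivAt W (-(x * W x)) x := by
  have h1 : HasDerivAt (fun t : ℝ => -t ^ 2 / 2) (-x) x := by
    have := (((hasDerivAt_id x).pow 2).neg).div_const 2
    refine this.congr_deriv ?_
    simp
    ring
  refine h1.exp.congr_deriv ?_
  simp only [W]; ring

lemma W_eq : W = fun t : ℝ => Real.exp (-(1/2 : ℝ) * t ^ 2) := by
  funext t; simp only [W]; congr 1; ring

lemma continuous_W : Continuous W := by unfold W; fun_prop

lemma integrable_W : Integrable W := by
  rw [W_eq]; exact integrable_exp_neg_mul_sq (by norm_num)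

lemma integrable_id_W : Integrable (fun t => t * W t) := by
  rw [W_eq]; exact integrable_mul_exp_neg_mul_sq (by norm_num)

lemma integral_W : ∫ t, W t = T := by
  rw [W_eq, integral_gaussian, T]; congr 1; ring

lemma tendsto_W_atTop : Tendsto W atTop (𝓝 0) := by
  refine Real.tendsto_exp_atBot.comp ?_
  have h1 : Tendsto (fun t : ℝ => t ^ 2 / 2) atTop atTop :=
    (tendsto_pow_atTop (by norm_num)).atTop_div_const (by norm_num)
  refine (tendsto_neg_atTop_atBot.comp h1).congr ?_
  intro t; simp only [Function.comp]; ring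

lemma tendsto_W_atBot : Tendsto W atBot (𝓝 0) := by
  refine (tendsto_W_atTop.comp tendsto_neg_atBot_atTop).congr ?_
  intro x; simp [W_neg]

lemma Iio_eq {g : ℝ → ℝ} (hi : Integrable g) (x : ℝ) :
    ∫ t in Iio x, g t = (∫ t in Iic 0, g t) + ∫ t in (0:ℝ)..x, g t := by
  rw [← integral_Iic_eq_integral_Iio,
    ← intervalIntegral.integral_Iic_sub_Iic hi.integrableOn hi.integrableOn]
  ring

lemma hasDerivAt_Iio {g : ℝ → ℝ} (hi : Integrable g) (hc : Continuous g) (x : ℝ) :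
    HasDerivAt (fun x => ∫ t in Iio x, g t) (g x) x := by
  have : (fun x => ∫ t in Iio x, g t) =
      fun x => (∫ t in Iic 0, g t) + ∫ t in (0:ℝ)..x, g t := funext (Iio_eq hi)
  rw [this]
  exact (hc.integral_hasStrictDerivAt 0 x).hasDerivAt.const_add _

lemma tendsto_Iio_atTop {g : ℝ → ℝ} (hi : Integrable g) :
    Tendsto (fun x => ∫ t in Iio x, g t) atTop (𝓝 (∫ t, g t)) := by
  have : (fun x => ∫ t in Iio x, g t) =
      fun x => (∫ t in Iic 0, g t) + ∫ t in (0:ℝ)..x, g t := funext (Iio_eq hi)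
  rw [this, ← intervalIntegral.integral_Iic_add_Ioi (b := 0) hi.integrableOn hi.integrableOn]
  exact (intervalIntegral_tendsto_integral_Ioi 0 hi.integrableOn tendsto_id).const_add _

lemma tendsto_Iio_atBot {g : ℝ → ℝ} (hi : Integrable g) :
    Tendsto (fun x => ∫ t in Iio x, g t) atBot (𝓝 0) := by
  have : (fun x => ∫ t in Iio x, g t) =
      fun x => (∫ t in Iic 0, g t) - ∫ t in x..(0:ℝ), g t := by
    funext x
    rw [Iio_eq hi, intervalIntegral.integral_symm]; ring
  rw [this]
  have := (intervalIntegral_tendsto_integral_Iic 0 hi.integrableOn tendsto_id).const_sub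
    (∫ t in Iic 0, g t)
  simpa using this

lemma hasDerivAt_P (x : ℝ) : HasDerivAt P (W x) x := hasDerivAt_Iio integrable_W continuous_W x

lemma tendsto_P_atTop : Tendsto P atTop (𝓝 T) := by
  rw [← integral_W]; exact tendsto_Iio_atTop integrable_W

lemma tendsto_P_atBot : Tendsto P atBot (𝓝 0) := tendsto_Iio_atBot integrable_W

lemma integral_Ioi_W (x : ℝ) : ∫ t in Ioi x, W t = T - P x := by
  rw [← integral_W, ← intervalIntegral.integral_Iic_add_Ioi (b := x) integrable_W.integrableOn
    integrable_W.integrableOn, integral_Iic_eq_integral_Iio, P]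
  ring

lemma P_neg (x : ℝ) : P (-x) = T - P x := by
  rw [← integral_Ioi_W, P, ← integral_Iic_eq_integral_Iio]
  have := integral_comp_neg_Iic (-x) W
  simpa [W_neg] using this

lemma P_zero : P 0 = T / 2 := by
  have := P_neg 0
  rw [neg_zero] at this; linarith

lemma P_nonneg (x : ℝ) : 0 ≤ P x := integral_nonneg fun t => (W_pos t).le

lemma P_le (x : ℝ) : P x ≤ T := by
  have h1 := P_nonneg (-x)
  rw [P_neg] at h1; linarith

lemma integral_Iio_id (x : ℝ) : ∫ t in Iio x, t * W t = - W x := by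
  rw [← integral_Iic_eq_integral_Iio]
  have := integral_Iic_of_hasDerivAt_of_tendsto' (a := x) (f := fun t => - W t)
    (f' := fun t => t * W t) (m := 0) (fun t _ => (hasDerivAt_W t).neg.congr_deriv (neg_neg _))
    integrable_id_W.integrableOn (by simpa using tendsto_W_atBot.neg)
  simpa using this

lemma integral_Ioi_id (x : ℝ) : ∫ t in Ioi x, t * W t = W x := by
  have := integral_Ioi_of_hasDerivAt_of_tendsto' (a := x) (f := fun t => - W t)
    (f' := fun t => t * W t) (m := 0) (fun t _ => (hasDerivAt_W t).neg.congr_deriv (neg_neg _))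
    integrable_id_W.integrableOn (by simpa using tendsto_W_atTop.neg)
  simpa using this

lemma integral_Iio_A (x : ℝ) : ∫ t in Iio x, (x - t) * W t = x * P x + W x := by
  simp_rw [sub_mul]
  rw [integral_sub (integrable_W.const_mul x).integrableOn integrable_id_W.integrableOn,
    integral_const_mul, integral_Iio_id, P]
  ring

lemma integral_Ioi_B (x : ℝ) : ∫ t in Ioi x, (t - x) * W t = W x - x * (T - P x) := by
  simp_rw [sub_mul]
  rw [integral_sub integrable_id_W.integrableOn (integrable_W.const_mul x).integrableOn,
    integral_const_mul, integral_Ioi_id, integral_Ioi_W]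

lemma A_nonneg (x : ℝ) : 0 ≤ x * P x + W x := by
  rw [← integral_Iio_A]
  exact setIntegral_nonneg measurableSet_Iio fun t ht =>
    mul_nonneg (sub_nonneg.2 (le_of_lt ht)) (W_pos t).le

lemma B_nonneg (x : ℝ) : 0 ≤ W x - x * (T - P x) := by
  rw [← integral_Ioi_B]
  exact setIntegral_nonneg measurableSet_Ioi fun t ht =>
    mul_nonneg (sub_nonneg.2 (le_of_lt ht)) (W_pos t).le

/-- Mills ratio lower bound, left tail. -/
lemma U_nonneg (x : ℝ) : 0 ≤ (1 + x ^ 2) * P x + x * W x := by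
  let F : ℝ → ℝ := fun x => P x + x / (1 + x ^ 2) * W x
  have hpos : ∀ x : ℝ, 0 < 1 + x ^ 2 := fun x => by positivity
  have hder : ∀ x, HasDerivAt F (2 * W x / (1 + x ^ 2) ^ 2) x := by
    intro x
    have h1 : HasDerivAt (fun x : ℝ => 1 + x ^ 2) (2 * x) x := by
      simpa using ((hasDerivAt_id x).pow 2).const_add 1
    have h2 := (hasDerivAt_P x).add
      (((hasDerivAt_id x).div h1 (hpos x).ne').mul (hasDerivAt_W x))
    refine h2.congr_deriv ?_
    have := (hpos x).ne'
    simp only [id, Pi.div_apply]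
    field_simp
    ring
  have hmono : Monotone F := monotone_of_deriv_nonneg (fun x => (hder x).differentiableAt)
    (fun x => by rw [(hder x).deriv]; have := W_pos x; positivity)
  have hlim : Tendsto F atBot (𝓝 0) := by
    have h2 : Tendsto (fun x : ℝ => x / (1 + x ^ 2) * W x) atBot (𝓝 0) := by
      refine squeeze_zero_norm (fun x => ?_) tendsto_W_atBot
      rw [norm_mul, Real.norm_of_nonneg (W_pos x).le]
      refine mul_le_of_le_one_left (W_pos x).le ?_
      rw [Real.norm_eq_abs, abs_div, abs_of_pos (hpos x), div_le_one (hpos x), abs_le]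
      constructor <;> nlinarith [sq_nonneg (x - 1), sq_nonneg (x + 1)]
    simpa using tendsto_P_atBot.add h2
  have h0 : 0 ≤ F x := hmono.le_of_tendsto hlim x
  have h3 : (1 + x ^ 2) * P x + x * W x = (1 + x ^ 2) * F x := by
    have := (hpos x).ne'
    simp only [F]; field_simp
  rw [h3]
  exact mul_nonneg (hpos x).le h0

lemma V_nonneg (x : ℝ) : 0 ≤ (1 + x ^ 2) * (T - P x) - x * W x := by
  have h1 := U_nonneg (-x)
  rw [P_neg, W_neg] at h1
  nlinarith

lemma monoOn {D : Set ℝ} (hD : Convex ℝ D) {f f' : ℝ → ℝ}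
    (hf : ∀ x ∈ D, HasDerivAt f (f' x) x) (h0 : ∀ x ∈ D, 0 ≤ f' x) : MonotoneOn f D := by
  refine monotoneOn_of_deriv_nonneg hD
    (fun x hx => (hf x hx).continuousAt.continuousWithinAt)
    (fun x hx => (hf x (interior_subset hx)).differentiableAt.differentiableWithinAt)
    (fun x hx => ?_)
  rw [(hf x (interior_subset hx)).deriv]
  exact h0 x (interior_subset hx)

lemma hasDerivAt_p (x : ℝ) : HasDerivAt (fun x => 2 * P x - T) (2 * W x) x :=
  ((hasDerivAt_P x).const_mul 2).sub_const T

lemma xW_le (x : ℝ) (hx : 0 ≤ x) : x * W x ≤ 2 * P x - T := by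
  have hder : ∀ x ∈ (univ : Set ℝ), HasDerivAt (fun x => (2 * P x - T) - x * W x)
      ((1 + x ^ 2) * W x) x := by
    intro x _
    refine ((hasDerivAt_p x).sub ((hasDerivAt_id' x).mul (hasDerivAt_W x))).congr_deriv ?_
    ring
  have hm := monoOn convex_univ hder (fun x _ => by have := W_pos x; positivity)
  have := hm (mem_univ 0) (mem_univ x) hx
  simp only [P_zero] at this
  linarith

lemma S_nonneg (x : ℝ) (hx : 0 ≤ x) :
    0 ≤ x * W x + (2 * P x - T) * (x ^ 2 / 4 - 1 / 2) := by
  have hq : ∀ x : ℝ, HasDerivAt (fun x : ℝ => x ^ 2 / 4 - 1 / 2) (x / 2) x := by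
    intro x
    refine (((hasDerivAt_pow 2 x).div_const 4).sub_const _).congr_deriv ?_
    simp; ring
  have hder : ∀ x ∈ Ici (0:ℝ), HasDerivAt
      (fun x => x * W x + (2 * P x - T) * (x ^ 2 / 4 - 1 / 2))
      (x / 2 * ((2 * P x - T) - x * W x)) x := by
    intro x _
    refine (((hasDerivAt_id' x).mul (hasDerivAt_W x)).add
      ((hasDerivAt_p x).mul (hq x))).congr_deriv ?_
    ring
  have hm := monoOn (convex_Ici 0) hder (fun x hx => by
    have h1 : (0:ℝ) ≤ x := hx
    have := xW_le x h1
    exact mul_nonneg (by linarith) (by linarith))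
  have := hm (self_mem_Ici) (show x ∈ Ici (0:ℝ) from hx) hx
  simp only [P_zero] at this
  linarith

lemma E_nonpos (x : ℝ) (hx : 0 < x) :
    ((2 * P x - T) * W x * (1 + x ^ 2) + x * W x ^ 2) / (x / 2 + x ^ 3 / 4)
      - (T ^ 2 - (2 * P x - T) ^ 2) ≤ 0 := by
  have hd : ∀ x : ℝ, HasDerivAt (fun x : ℝ => x / 2 + x ^ 3 / 4) (1 / 2 + 3 * x ^ 2 / 4) x := by
    intro x
    refine (((hasDerivAt_id' x).div_const 2).add
      ((hasDerivAt_pow 3 x).div_const 4)).congr_deriv ?_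
    simp
  have hq : ∀ x : ℝ, HasDerivAt (fun x : ℝ => 1 + x ^ 2) (2 * x) x := by
    intro x
    refine ((hasDerivAt_pow 2 x).const_add 1).congr_deriv ?_
    simp
  have hW2 : ∀ x : ℝ, HasDerivAt (fun x : ℝ => W x ^ 2) (2 * W x * (-(x * W x))) x := by
    intro x
    refine ((hasDerivAt_W x).pow 2).congr_deriv ?_
    simp
  have hp2 : ∀ x : ℝ, HasDerivAt (fun x : ℝ => (2 * P x - T) ^ 2)
      (2 * (2 * P x - T) * (2 * W x)) x := by
    intro x
    refine ((hasDerivAt_p x).pow 2).congr_deriv ?_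
    simp
  let E : ℝ → ℝ := fun x =>
    ((2 * P x - T) * W x * (1 + x ^ 2) + x * W x ^ 2) / (x / 2 + x ^ 3 / 4)
      - (T ^ 2 - (2 * P x - T) ^ 2)
  have hder : ∀ x ∈ Ioi (0:ℝ), HasDerivAt E
      (W x * (x * W x + (2 * P x - T) * (x ^ 2 / 4 - 1 / 2)) / (x / 2 + x ^ 3 / 4) ^ 2) x := by
    intro x hx
    have h0 : (0:ℝ) < x := hx
    have hne : x / 2 + x ^ 3 / 4 ≠ 0 := by positivity
    have hN : HasDerivAt (fun x => (2 * P x - T) * W x * (1 + x ^ 2) + x * W x ^ 2)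
        (3 * W x ^ 2 + (2 * P x - T) * W x * (x - x ^ 3)) x := by
      refine ((((hasDerivAt_p x).mul (hasDerivAt_W x)).mul (hq x)).add
        ((hasDerivAt_id' x).mul (hW2 x))).congr_deriv ?_
      simp only [Pi.mul_apply]
      ring
    refine ((hN.div (hd x) hne).sub ((hp2 x).const_sub (T ^ 2))).congr_deriv ?_
    rw [eq_div_iff (pow_ne_zero 2 hne), sub_mul, div_mul_cancel₀ _ (pow_ne_zero 2 hne)]
    ring
  have hm := monoOn (convex_Ioi 0) hder (fun x hx => by
    have h1 : (0:ℝ) < x := hx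
    have := S_nonneg x h1.le
    have := W_pos x
    positivity)
  have hp1 : Tendsto (fun x => 2 * P x - T) atTop (𝓝 T) := by
    have := (tendsto_P_atTop.const_mul 2).sub_const T
    convert this using 2; ring
  have hlim : Tendsto E atTop (𝓝 0) := by
    have h1 : Tendsto (fun x => ((2 * P x - T) * W x * (1 + x ^ 2) + x * W x ^ 2)
        / (x / 2 + x ^ 3 / 4)) atTop (𝓝 0) := by
      have hb : Tendsto (fun x => 4 * ((2 * P x - T) * W x) + 4 * W x ^ 2) atTop (𝓝 0) := by
        have := ((hp1.mul tendsto_W_atTop).const_mul 4).add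
          ((tendsto_W_atTop.pow 2).const_mul 4)
        simpa using this
      refine squeeze_zero' ?_ ?_ hb
      · filter_upwards [eventually_ge_atTop (1:ℝ)] with x hx
        have h0 : (0:ℝ) < x := by linarith
        have hw := W_pos x
        have := xW_le x h0.le
        have hp : 0 ≤ 2 * P x - T := le_trans (by positivity) this
        positivity
      · filter_upwards [eventually_ge_atTop (1:ℝ)] with x hx
        have h0 : (0:ℝ) < x := by linarith
        have hw := W_pos x
        have := xW_le x h0.le
        have hp : 0 ≤ 2 * P x - T := le_trans (by positivity) this
        rw [div_le_iff₀ (by positivity)]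
        have e1 : 1 + x ^ 2 ≤ 4 * (x / 2 + x ^ 3 / 4) := by nlinarith [sq_nonneg x]
        have e2 : x ≤ 4 * (x / 2 + x ^ 3 / 4) := by nlinarith [sq_nonneg x]
        have e3 := mul_le_mul_of_nonneg_left e1 (mul_nonneg hp hw.le)
        have e4 := mul_le_mul_of_nonneg_right e2 (sq_nonneg (W x))
        nlinarith
    have h2 : Tendsto (fun x => T ^ 2 - (2 * P x - T) ^ 2) atTop (𝓝 0) := by
      have := (hp1.pow 2).const_sub (T ^ 2)
      rwa [sub_self] at this
    simpa using h1.sub h2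
  refine ge_of_tendsto hlim ?_
  filter_upwards [eventually_ge_atTop x] with y hy
  exact hm (show x ∈ Ioi (0:ℝ) from hx) (show y ∈ Ioi (0:ℝ) from lt_of_lt_of_le hx hy) hy

lemma AB_le_of_nonneg (x : ℝ) (hx : 0 ≤ x) :
    (x * P x + W x) * (W x - x * (T - P x)) ≤ W x := by
  have hA : ∀ x : ℝ, HasDerivAt (fun x => x * P x + W x) (P x) x := by
    intro x
    refine (((hasDerivAt_id' x).mul (hasDerivAt_P x)).add (hasDerivAt_W x)).congr_deriv ?_
    ring
  have hB : ∀ x : ℝ, HasDerivAt (fun x => W x - x * (T - P x)) (-(T - P x)) x := by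
    intro x
    refine ((hasDerivAt_W x).sub ((hasDerivAt_id' x).mul
      ((hasDerivAt_P x).const_sub T))).congr_deriv ?_
    ring
  have hder : ∀ x ∈ Ici (0:ℝ), HasDerivAt
      (fun x => -((x * P x + W x) * (W x - x * (T - P x)) / W x))
      (-(((2 * P x - T) * W x * (1 + x ^ 2) + x * W x ^ 2)
      - (x / 2 + x ^ 3 / 4) * (T ^ 2 - (2 * P x - T) ^ 2)) / W x) x := by
    intro x _
    refine (((hA x).mul (hB x)).div (hasDerivAt_W x) (W_pos x).ne').neg.congr_deriv ?_
    have := (W_pos x).ne'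
    simp only [Pi.mul_apply]
    field_simp
    ring
  have hm := monoOn (convex_Ici 0) hder (fun x hx => by
    have h1 : (0:ℝ) ≤ x := hx
    refine div_nonneg ?_ (W_pos x).le
    rcases h1.eq_or_lt with h2 | h2
    · subst h2
      simp [P_zero]
      rw [W_zero]; linarith
    · have h3 := E_nonpos x h2
      have hpos : 0 < x / 2 + x ^ 3 / 4 := by positivity
      rw [sub_nonpos, div_le_iff₀ hpos] at h3
      nlinarith)
  have := hm (self_mem_Ici) (show x ∈ Ici (0:ℝ) from hx) hx
  simp only [W_zero] at this
  have h2 : (x * P x + W x) * (W x - x * (T - P x)) / W x ≤ 1 := by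
    norm_num at this
    linarith
  rwa [div_le_one (W_pos x)] at h2

lemma AB_le (x : ℝ) : (x * P x + W x) * (W x - x * (T - P x)) ≤ W x := by
  rcases le_total 0 x with h | h
  · exact AB_le_of_nonneg x h
  · have := AB_le_of_nonneg (-x) (by linarith)
    rw [P_neg, W_neg] at this
    nlinarith

/-- The four scalar estimates, packaged: `I`, `J` are the two truncated integrals. -/
lemma bound_lin {a b I J A B w : ℝ} (ha : 0 ≤ a) (hb : 0 ≤ b) (hI : |I| ≤ A) (hJ : |J| ≤ B)
    (hw : a * A + b * B ≤ w) : |a * I + b * J| ≤ w ∧ |a * I - b * J| ≤ w := by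
  have h1 := mul_le_mul_of_nonneg_left (abs_le.1 hI).1 ha
  have h2 := mul_le_mul_of_nonneg_left (abs_le.1 hI).2 ha
  have h3 := mul_le_mul_of_nonneg_left (abs_le.1 hJ).1 hb
  have h4 := mul_le_mul_of_nonneg_left (abs_le.1 hJ).2 hb
  constructor <;> rw [abs_le] <;> constructor <;> nlinarith

lemma lip {h : ℝ → ℝ} (hC1 : ContDiff ℝ 1 h) (hd : ∀ x, |deriv h x| ≤ 1) (x y : ℝ) :
    |h y - h x| ≤ |y - x| := by
  have := convex_univ.norm_image_sub_le_of_norm_deriv_le (f := h) (C := 1) (x := x) (y := y)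
    (fun z _ => (hC1.differentiable (by norm_num)) z) (fun z _ => hd z) (mem_univ _) (mem_univ _)
  simpa using this

lemma integrable_hW {h : ℝ → ℝ} (hC1 : ContDiff ℝ 1 h) (hd : ∀ x, |deriv h x| ≤ 1) (c : ℝ) :
    Integrable (fun t => (h t - c) * W t) := by
  have hb : Integrable (fun t => |h 0 - c| * W t + ‖t * W t‖) :=
    (integrable_W.const_mul _).add integrable_id_W.norm
  refine hb.mono' ?_ (ae_of_all _ fun t => ?_)
  · exact ((hC1.continuous.sub continuous_const).mul continuous_W).aestronglyMeasurable
  · rw [norm_mul, norm_mul, Real.norm_of_nonneg (W_pos t).le, ← add_mul]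
    refine mul_le_mul_of_nonneg_right ?_ (W_pos t).le
    have h1 := lip hC1 hd 0 t
    rw [sub_zero] at h1
    have h2 := abs_add_le (h 0 - c) (h t - h 0)
    rw [Real.norm_eq_abs, Real.norm_eq_abs]
    have h3 : h 0 - c + (h t - h 0) = h t - c := by ring
    rw [h3] at h2
    linarith

lemma mean_eq (h : ℝ → ℝ) : T * ∫ z, h z ∂(gaussianReal 0 1) = ∫ z, h z * W z := by
  rw [integral_gaussianReal_eq_integral_smul one_ne_zero, ← integral_const_mul]
  congr 1
  funext z
  have hT : T ≠ 0 := T_pos.ne'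
  have hT2 : √(2 * Real.pi) = T := rfl
  simp only [gaussianPDFReal, smul_eq_mul, NNReal.coe_one, mul_one, sub_zero, W, hT2]
  field_simp

end Stein6

open Stein6 Set Filter Topology in

/-- the Stein solution `f_h` for a `C¹` function `h` with `‖h'‖_∞ ≤ 1` is
twice differentiable, solves `f' − x f = h − ∫ h dγ` with the bounds `‖f_h‖_∞ ≤ 2`,
`‖f_h'‖_∞ ≤ √(2/π)`, `‖f_h''‖_∞ ≤ 2`, and is the unique differentiable solution of the
Stein equation satisfying the decay condition `e^{−x²/2} g(x) → 0` as `|x| → ∞`. -/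
theorem stmt6 (h : ℝ → ℝ) (hC1 : ContDiff ℝ 1 h) (hd : ∀ x, |deriv h x| ≤ 1)
    (fh : ℝ → ℝ)
    (hfh : ∀ x, fh x = Real.exp (x ^ 2 / 2) *
      ∫ t in Set.Iio x, (h t - ∫ z, h z ∂(gaussianReal 0 1)) * Real.exp (-t ^ 2 / 2)) :
    Differentiable ℝ fh ∧ Differentiable ℝ (deriv fh) ∧
    (∀ x, deriv fh x - x * fh x = h x - ∫ z, h z ∂(gaussianReal 0 1)) ∧
    (∀ x, |fh x| ≤ 2) ∧
    (∀ x, |deriv fh x| ≤ Real.sqrt (2 / Real.pi)) ∧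
    (∀ x, |deriv (deriv fh) x| ≤ 2) ∧
    Filter.Tendsto (fun x => Real.exp (-x ^ 2 / 2) * fh x) (Filter.cocompact ℝ) (nhds 0) ∧
    (∀ g : ℝ → ℝ, Differentiable ℝ g →
      (∀ x, deriv g x - x * g x = h x - ∫ z, h z ∂(gaussianReal 0 1)) →
      Filter.Tendsto (fun x => Real.exp (-x ^ 2 / 2) * g x) (Filter.cocompact ℝ) (nhds 0) →
      g = fh) := by
  set m := ∫ z, h z ∂(gaussianReal 0 1) with hm
  have hdiff : Differentiable ℝ h := hC1.differentiable (by norm_num)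
  have hint : ∀ c, Integrable (fun t => (h t - c) * W t) := integrable_hW hC1 hd
  have hcont : Continuous (fun t => (h t - m) * W t) :=
    (hC1.continuous.sub continuous_const).mul continuous_W
  set F : ℝ → ℝ := fun x => ∫ t in Iio x, (h t - m) * W t with hF
  have hF' : ∀ x, HasDerivAt F ((h x - m) * W x) x := hasDerivAt_Iio (hint m) hcont
  have hTm : T * m = ∫ z, h z * W z := mean_eq h
  have htot : ∀ c, ∫ t, (h t - c) * W t = T * (m - c) := by
    intro c
    have h0 := hint 0
    simp only [sub_zero] at h0
    simp_rw [sub_mul]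
    rw [integral_sub h0 (integrable_W.const_mul c), integral_const_mul, integral_W, ← hTm]
    ring
  have hWE : ∀ x, Real.exp (x ^ 2 / 2) * W x = 1 := by
    intro x
    rw [W, ← Real.exp_add]
    simp [neg_div]
  have hWf : ∀ x, W x * fh x = F x := by
    intro x
    rw [hfh x]
    have : (∫ t in Iio x, (h t - m) * Real.exp (-t ^ 2 / 2)) = F x := rfl
    rw [this]
    linear_combination F x * hWE x
  have hfF : fh = fun x => Real.exp (x ^ 2 / 2) * F x := by
    funext x; exact hfh x
  have hf' : ∀ x, HasDerivAt fh (x * fh x + (h x - m)) x := by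
    intro x
    have h1 : HasDerivAt (fun x : ℝ => Real.exp (x ^ 2 / 2)) (Real.exp (x ^ 2 / 2) * x) x := by
      refine ((hasDerivAt_pow 2 x).div_const 2).exp.congr_deriv ?_
      simp
    have h2 := h1.mul (hF' x)
    have h3 : fh x = Real.exp (x ^ 2 / 2) * F x := by rw [hfF]
    rw [h3]
    rw [hfF]
    refine h2.congr_deriv ?_
    linear_combination (h x - m) * hWE x
  have hdf : deriv fh = fun x => x * fh x + (h x - m) := funext fun x => (hf' x).deriv
  have hf'' : ∀ x, HasDerivAt (deriv fh) (fh x + x * deriv fh x + deriv h x) x := by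
    intro x
    rw [hdf]
    refine (((hasDerivAt_id' x).mul (hf' x)).add
      ((hdiff x).hasDerivAt.sub_const m)).congr_deriv ?_
    ring
  have hlim : Tendsto F (cocompact ℝ) (𝓝 0) := by
    rw [cocompact_eq_atBot_atTop, tendsto_sup]
    refine ⟨tendsto_Iio_atBot (hint m), ?_⟩
    have := tendsto_Iio_atTop (hint m)
    rwa [htot, sub_self, mul_zero] at this
  -- the key representation
  have hkey : ∀ x, ∃ I J : ℝ, |I| ≤ x * P x + W x ∧ |J| ≤ W x - x * (T - P x) ∧
      I + J = T * (m - h x) ∧ T * F x = (T - P x) * I - P x * J := by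
    intro x
    have hsum : (∫ t in Iio x, (h t - h x) * W t) + (∫ t in Ioi x, (h t - h x) * W t)
        = T * (m - h x) := by
      rw [← htot (h x), ← integral_Iic_eq_integral_Iio]
      exact intervalIntegral.integral_Iic_add_Ioi (hint _).integrableOn (hint _).integrableOn
    refine ⟨∫ t in Iio x, (h t - h x) * W t, ∫ t in Ioi x, (h t - h x) * W t, ?_, ?_, hsum, ?_⟩
    · rw [← integral_Iio_A, ← Real.norm_eq_abs]
      refine norm_integral_le_of_norm_le ?_ ?_
      · have : Integrable (fun t => x * W t - t * W t) :=
          (integrable_W.const_mul x).sub integrable_id_W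
        simp_rw [sub_mul]
        exact this.integrableOn
      · refine (ae_restrict_iff' measurableSet_Iio).2 (ae_of_all _ fun t ht => ?_)
        have ht' : t < x := ht
        rw [norm_mul, Real.norm_of_nonneg (W_pos t).le]
        refine mul_le_mul_of_nonneg_right ?_ (W_pos t).le
        have := lip hC1 hd x t
        rwa [abs_of_neg (by linarith : t - x < 0), neg_sub] at this
    · rw [← integral_Ioi_B, ← Real.norm_eq_abs]
      refine norm_integral_le_of_norm_le ?_ ?_
      · have : Integrable (fun t => t * W t - x * W t) :=
          integrable_id_W.sub (integrable_W.const_mul x)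
        simp_rw [sub_mul]
        exact this.integrableOn
      · refine (ae_restrict_iff' measurableSet_Ioi).2 (ae_of_all _ fun t ht => ?_)
        have ht' : x < t := ht
        rw [norm_mul, Real.norm_of_nonneg (W_pos t).le]
        refine mul_le_mul_of_nonneg_right ?_ (W_pos t).le
        have := lip hC1 hd x t
        rwa [abs_of_pos (by linarith : 0 < t - x)] at this
    · have h1 : F x = (∫ t in Iio x, (h t - h x) * W t) + (h x - m) * P x := by
        rw [P, ← integral_const_mul, ← integral_add (hint _).integrableOn
          (integrable_W.const_mul _).integrableOn]
        simp only [hF]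
        congr 1
        funext t; ring
      rw [h1]
      linear_combination P x * hsum
  have hTW : ∀ x, 0 < T * W x := fun x => mul_pos T_pos (W_pos x)
  have habs : ∀ x y c : ℝ, |T * W x * y| ≤ T * W x * c → |y| ≤ c := by
    intro x y c hyc
    rw [abs_mul, abs_of_pos (hTW x)] at hyc
    exact le_of_mul_le_mul_left hyc (hTW x)
  have hTsq : T * √(2 / Real.pi) = 2 := by
    have hpi := Real.pi_pos
    rw [T, ← Real.sqrt_mul (by positivity)]
    have : 2 * Real.pi * (2 / Real.pi) = 2 ^ 2 := by field_simp
    rw [this, Real.sqrt_sq (by norm_num)]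
  refine ⟨fun x => (hf' x).differentiableAt, fun x => (hf'' x).differentiableAt, ?_, ?_, ?_, ?_,
    ?_, ?_⟩
  · intro x; rw [(hf' x).deriv]; ring
  · intro x
    obtain ⟨I, J, hI, hJ, hs, hTF⟩ := hkey x
    have hb := (bound_lin (sub_nonneg.2 (P_le x)) (P_nonneg x) hI hJ
      (w := T * W x) (by apply le_of_eq; ring)).2
    have : |fh x| ≤ 1 := by
      refine habs x _ _ ?_
      rw [mul_assoc, hWf, hTF, mul_one]
      exact hb
    linarith
  · intro x
    obtain ⟨I, J, hI, hJ, hs, hTF⟩ := hkey x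
    have hb := (bound_lin (B_nonneg x) (A_nonneg x) hI hJ
      (w := 2 * W x) (by linarith [AB_le x])).1
    refine habs x _ _ ?_
    have e1 : T * W x * deriv fh x
        = -((W x - x * (T - P x)) * I + (x * P x + W x) * J) := by
      rw [(hf' x).deriv]
      linear_combination T * x * hWf x + x * hTF + W x * hs
    rw [e1, abs_neg]
    refine hb.trans (le_of_eq ?_)
    linear_combination (-W x) * hTsq
  · intro x
    obtain ⟨I, J, hI, hJ, hs, hTF⟩ := hkey x
    have hb := (bound_lin (V_nonneg x) (U_nonneg x) hI hJ
      (w := T * W x) (by apply le_of_eq; ring)).2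
    have h1 : |fh x + x * deriv fh x| ≤ 1 := by
      refine habs x _ _ ?_
      have e1 : T * W x * (fh x + x * deriv fh x)
          = ((1 + x ^ 2) * (T - P x) - x * W x) * I - ((1 + x ^ 2) * P x + x * W x) * J := by
        rw [(hf' x).deriv]
        linear_combination T * (1 + x ^ 2) * hWf x + (1 + x ^ 2) * hTF + x * W x * hs
      rw [e1, mul_one]
      exact hb
    rw [(hf'' x).deriv]
    have h2 := abs_add_le (fh x + x * deriv fh x) (deriv h x)
    have h3 := hd x
    linarith
  · refine hlim.congr fun x => ?_
    exact (hWf x).symm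
  · intro g hg hgeq hglim
    have hglim' : Tendsto (fun x => W x * g x) (cocompact ℝ) (𝓝 0) := hglim
    have hder : ∀ x, HasDerivAt (fun x => W x * g x - F x) 0 x := by
      intro x
      refine (((hasDerivAt_W x).mul (hg x).hasDerivAt).sub (hF' x)).congr_deriv ?_
      linear_combination W x * hgeq x
    have hconst := is_const_of_deriv_eq_zero (fun x => (hder x).differentiableAt)
      (fun x => (hder x).deriv)
    have hl : Tendsto (fun x => W x * g x - F x) (cocompact ℝ) (𝓝 0) := by
      simpa using hglim'.sub hlim
    funext x
    have hl2 : Tendsto (fun _ : ℝ => W x * g x - F x) (cocompact ℝ) (𝓝 0) :=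
      hl.congr fun y => hconst y x
    have hz := tendsto_nhds_unique tendsto_const_nhds hl2
    have : W x * g x = W x * fh x := by rw [hWf]; linarith
    exact mul_left_cancel₀ (W_pos x).ne' this
end
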